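/- Let A = kQ/I be a gentle one-cycle algebra whose unique cycle 𝒞 = a_1⋯a_l (with s(a_i) = i) is a full-relational oriented cycle, and let 1 ≤ t ≤ l. Then for every indecomposable projective right Ā_{𝒞,t}-module P with P ≇ ε̄_{t(a_t)}Ā_{𝒞,t}, the right A-module 𝔢_{𝒞,t}(P) obtained by viewing P as an A-module via the quotient map A → Ā_{𝒞,t} is not a non-projective indecomposable G-projective A-module. -/

import Mathlib

/- Common infrastructure: finite quivers, path algebras, gentle algebras,
   right modules, Gorenstein projective modules, etc. -/

open MulOpposite

noncomputable section

/-- A finite quiver, with `nV` vertices and `nE` arrows. -/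
structure QuiverData where
  nV : ℕ
  nE : ℕ
  src : Fin nE → Fin nV
  tgt : Fin nE → Fin nV

/-- The relations defining the path algebra `kQ` as a quotient of the free
algebra on the set of vertices and arrows:  the trivial paths `e_v` are
orthogonal idempotents summing to `1`, and `e_{s(a)} * a = a = a * e_{t(a)}`.
(Paths are composed left-to-right, matching the paper's convention.) -/
inductive PathRel (k : Type) [Field k] (Q : QuiverData) :
    FreeAlgebra k (Fin Q.nV ⊕ Fin Q.nE) → FreeAlgebra k (Fin Q.nV ⊕ Fin Q.nE) → Prop
  | vtx_mul (v w : Fin Q.nV) : PathRel k Q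
      (FreeAlgebra.ι k (Sum.inl v) * FreeAlgebra.ι k (Sum.inl w))
      (if v = w then FreeAlgebra.ι k (Sum.inl v) else 0)
  | vtx_sum : PathRel k Q (∑ v : Fin Q.nV, FreeAlgebra.ι k (Sum.inl v)) 1
  | src_arr (e : Fin Q.nE) : PathRel k Q
      (FreeAlgebra.ι k (Sum.inl (Q.src e)) * FreeAlgebra.ι k (Sum.inr e))
      (FreeAlgebra.ι k (Sum.inr e))
  | arr_tgt (e : Fin Q.nE) : PathRel k Q
      (FreeAlgebra.ι k (Sum.inr e) * FreeAlgebra.ι k (Sum.inl (Q.tgt e)))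
      (FreeAlgebra.ι k (Sum.inr e))

/-- The path algebra `kQ`. -/
def PathAlg (k : Type) [Field k] (Q : QuiverData) := RingQuot (PathRel k Q)

instance (k : Type) [Field k] (Q : QuiverData) : Ring (PathAlg k Q) :=
  inferInstanceAs (Ring (RingQuot (PathRel k Q)))

instance (k : Type) [Field k] (Q : QuiverData) : Algebra k (PathAlg k Q) :=
  inferInstanceAs (Algebra k (RingQuot (PathRel k Q)))

/-- The arrow `e`, as an element of the path algebra. -/
def arr (k : Type) [Field k] (Q : QuiverData) (e : Fin Q.nE) : PathAlg k Q :=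
  RingQuot.mkAlgHom k (PathRel k Q) (FreeAlgebra.ι k (Sum.inr e))

/-- The trivial path (idempotent) at the vertex `v`, in the path algebra. -/
def vtx (k : Type) [Field k] (Q : QuiverData) (v : Fin Q.nV) : PathAlg k Q :=
  RingQuot.mkAlgHom k (PathRel k Q) (FreeAlgebra.ι k (Sum.inl v))

/-- Given a set `Rel` of (composable) pairs of arrows, the relation on `kQ`
identifying each corresponding length-two path with `0`; the quotient is
`kQ/I` where `I` is the two-sided ideal generated by these paths of length two. -/
def GRel (k : Type) [Field k] (Q : QuiverData) (Rel : Set (Fin Q.nE × Fin Q.nE)) :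
    PathAlg k Q → PathAlg k Q → Prop := fun x y =>
  (∃ p ∈ Rel, x = arr k Q p.1 * arr k Q p.2) ∧ y = 0

/-- The algebra `A = kQ/I`. -/
def GAlg (k : Type) [Field k] (Q : QuiverData) (Rel : Set (Fin Q.nE × Fin Q.nE)) :=
  RingQuot (GRel k Q Rel)

instance (k : Type) [Field k] (Q : QuiverData) (Rel : Set (Fin Q.nE × Fin Q.nE)) :
    Ring (GAlg k Q Rel) := inferInstanceAs (Ring (RingQuot (GRel k Q Rel)))

instance (k : Type) [Field k] (Q : QuiverData) (Rel : Set (Fin Q.nE × Fin Q.nE)) :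
    Algebra k (GAlg k Q Rel) := inferInstanceAs (Algebra k (RingQuot (GRel k Q Rel)))

/-- The canonical projection `kQ → kQ/I`. -/
def gmap (k : Type) [Field k] (Q : QuiverData) (Rel : Set (Fin Q.nE × Fin Q.nE)) :
    PathAlg k Q →ₐ[k] GAlg k Q Rel := RingQuot.mkAlgHom k (GRel k Q Rel)

/-- Membership in the ideal `I` (the kernel of `kQ → kQ/I`). -/
def inI (k : Type) [Field k] (Q : QuiverData) (Rel : Set (Fin Q.nE × Fin Q.nE))
    (x : PathAlg k Q) : Prop := gmap k Q Rel x = 0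

/-- The idempotent `ε_v ∈ A` at a vertex `v`. -/
def vtxA (k : Type) [Field k] (Q : QuiverData) (Rel : Set (Fin Q.nE × Fin Q.nE))
    (v : Fin Q.nV) : GAlg k Q Rel := gmap k Q Rel (vtx k Q v)

/-- The image in `A` of an arrow `e`. -/
def arrA (k : Type) [Field k] (Q : QuiverData) (Rel : Set (Fin Q.nE × Fin Q.nE))
    (e : Fin Q.nE) : GAlg k Q Rel := gmap k Q Rel (arr k Q e)

/-- `(Q, I)` is a gentle pair (with `I` the ideal generated by the length-two
paths coming from `Rel`), and moreover `I` is admissible. -/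
structure IsGentle (k : Type) [Field k] (Q : QuiverData)
    (Rel : Set (Fin Q.nE × Fin Q.nE)) : Prop where
  /-- the generating relations are composable length-two paths -/
  comp_rel : ∀ p ∈ Rel, Q.tgt p.1 = Q.src p.2
  /-- every vertex is the source of at most two arrows -/
  src_card : ∀ v, (Finset.univ.filter fun e => Q.src e = v).card ≤ 2
  /-- every vertex is the target of at most two arrows -/
  tgt_card : ∀ v, (Finset.univ.filter fun e => Q.tgt e = v).card ≤ 2
  /-- for each arrow `a` there is at most one arrow `b` with `ab ∉ I` -/
  uniq_nonrel_right : ∀ a b c, ¬ inI k Q Rel (arr k Q a * arr k Q b) →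
    ¬ inI k Q Rel (arr k Q a * arr k Q c) → b = c
  /-- for each arrow `a` there is at most one arrow `c` with `ca ∉ I` -/
  uniq_nonrel_left : ∀ a b c, ¬ inI k Q Rel (arr k Q b * arr k Q a) →
    ¬ inI k Q Rel (arr k Q c * arr k Q a) → b = c
  /-- for each arrow `a` there is at most one (composable) arrow `b` with `ab ∈ I` -/
  uniq_rel_right : ∀ a b c, Q.tgt a = Q.src b → Q.tgt a = Q.src c →
    inI k Q Rel (arr k Q a * arr k Q b) → inI k Q Rel (arr k Q a * arr k Q c) → b = c
  /-- for each arrow `a` there is at most one (composable) arrow `c` with `ca ∈ I` -/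
  uniq_rel_left : ∀ a b c, Q.tgt b = Q.src a → Q.tgt c = Q.src a →
    inI k Q Rel (arr k Q b * arr k Q a) → inI k Q Rel (arr k Q c * arr k Q a) → b = c
  /-- admissibility: some power of the arrow ideal is contained in `I` -/
  admissible : ∃ m, 2 ≤ m ∧ ∀ f : Fin m → Fin Q.nE,
    inI k Q Rel (List.ofFn fun i => arr k Q (f i)).prod

/-- A full-relational oriented cycle `𝒞 = a_1 ⋯ a_len` (of length ≥ 3, as assumed
throughout the paper) in the bound quiver `(Q, I)`, encoded by a periodic
sequence of arrows.  `arrows i` is the arrow `a_{i+1}` (`0`-indexed),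
consecutive arrows are composable, all consecutive length-two paths lie in `I`,
and the vertices of the cycle are pairwise distinct. -/
structure FRCycle (k : Type) [Field k] (Q : QuiverData)
    (Rel : Set (Fin Q.nE × Fin Q.nE)) where
  len : ℕ
  len3 : 3 ≤ len
  arrows : ℕ → Fin Q.nE
  periodic : ∀ i, arrows (i + len) = arrows i
  comp : ∀ i, Q.tgt (arrows i) = Q.src (arrows (i + 1))
  frel : ∀ i, inI k Q Rel (arr k Q (arrows i) * arr k Q (arrows (i + 1)))
  vinj : ∀ i j, i < len → j < len → Q.src (arrows i) = Q.src (arrows j) → i = j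

/-- There are no full-relational oriented cycles of length `< 3` (the blanket
assumption of the paper). -/
def NoShortFRC (k : Type) [Field k] (Q : QuiverData)
    (Rel : Set (Fin Q.nE × Fin Q.nE)) : Prop :=
  ∀ (l : ℕ) (c : ℕ → Fin Q.nE), 1 ≤ l → (∀ i, c (i + l) = c i) →
    (∀ i, Q.tgt (c i) = Q.src (c (i + 1))) →
    (∀ i, inI k Q Rel (arr k Q (c i) * arr k Q (c (i + 1)))) → 3 ≤ l

/-- The set of arrows lying on the cycle. -/
def FRCycle.arrowSet {k : Type} [Field k] {Q : QuiverData}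
    {Rel : Set (Fin Q.nE × Fin Q.nE)} (C : FRCycle k Q Rel) : Set (Fin Q.nE) :=
  {a | ∃ i < C.len, C.arrows i = a}

/-- The idempotent `ε_{𝒞,t} ∈ A`: the sum of the `ε_v` over the vertices `v`
of the cycle `𝒞` other than `s(a_t)` and `t(a_t)`. -/
def epsCt (k : Type) [Field k] (Q : QuiverData) (Rel : Set (Fin Q.nE × Fin Q.nE))
    (C : FRCycle k Q Rel) (t : ℕ) : GAlg k Q Rel :=
  ∑ i ∈ (Finset.range C.len).filter
      (fun i => Q.src (C.arrows i) ≠ Q.src (C.arrows t) ∧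
        Q.src (C.arrows i) ≠ Q.tgt (C.arrows t)),
    vtxA k Q Rel (Q.src (C.arrows i))

/-- The relation identifying an element `ε` of a ring with `0`; the quotient is
`R/RεR`. -/
def QuotRel (R : Type) [Ring R] (ε : R) : R → R → Prop := fun x y => x = ε ∧ y = 0

/-- The quotient ring `R/RεR`. -/
def QuotBy (R : Type) [Ring R] (ε : R) := RingQuot (QuotRel R ε)

instance (R : Type) [Ring R] (ε : R) : Ring (QuotBy R ε) :=
  inferInstanceAs (Ring (RingQuot (QuotRel R ε)))

/-- The canonical projection `R → R/RεR`. -/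
def qmap (R : Type) [Ring R] (ε : R) : R →+* QuotBy R ε := RingQuot.mkRingHom (QuotRel R ε)

/-- The right ideal `xR`, as a right `R`-module (i.e. an `Rᵐᵒᵖ`-submodule of `R`). -/
def rIdeal (R : Type) [Ring R] (x : R) : Submodule Rᵐᵒᵖ R := Submodule.span Rᵐᵒᵖ {x}

/-- Restriction of scalars along `π : R →+* S` turns a right `S`-module into a
right `R`-module. -/
def modRestrict {R S : Type} [Ring R] [Ring S] (π : R →+* S) (M : Type)
    [AddCommGroup M] [Module Sᵐᵒᵖ M] : Module Rᵐᵒᵖ M :=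
  Module.compHom M (RingHom.op π)

/-- `M` is a Gorenstein projective right `R`-module:  there is a complete
resolution, i.e. an exact sequence `⋯ → P⁻² → P⁻¹ → P⁰ → P¹ → ⋯` of finitely
generated projective right `R`-modules which stays exact after applying
`Hom_R(-, R)`, with `M ≅ Im(P⁻¹ → P⁰)`. -/
def IsGProjMod (R : Type) [Ring R] (M : Type) [AddCommGroup M] [Module Rᵐᵒᵖ M] : Prop :=
  ∃ (P : ℤ → ModuleCat.{0} Rᵐᵒᵖ) (d : (n : ℤ) → (P n →ₗ[Rᵐᵒᵖ] P (n + 1))),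
    (∀ n, Module.Finite Rᵐᵒᵖ (P n)) ∧
    (∀ n, Module.Projective Rᵐᵒᵖ (P n)) ∧
    (∀ n, LinearMap.range (d n) = LinearMap.ker (d (n + 1))) ∧
    (∀ (n : ℤ) (g : P (n + 1) →ₗ[Rᵐᵒᵖ] R),
      g.comp (d n) = 0 ↔ ∃ h : P (n + 1 + 1) →ₗ[Rᵐᵒᵖ] R, h.comp (d (n + 1)) = g) ∧
    Nonempty (M ≃ₗ[Rᵐᵒᵖ] LinearMap.range (d (-1)))

/-- `M` is an indecomposable `S`-module. -/
def IsIndec (S : Type) [Ring S] (M : Type) [AddCommGroup M] [Module S M] : Prop :=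
  Nontrivial M ∧ ∀ N₁ N₂ : Submodule S M, IsCompl N₁ N₂ → N₁ = ⊥ ∨ N₂ = ⊥

/-- `M` is a non-projective indecomposable Gorenstein projective right `R`-module. -/
def IsNPIGProj (R : Type) [Ring R] (M : Type) [AddCommGroup M] [Module Rᵐᵒᵖ M] : Prop :=
  IsGProjMod R M ∧ IsIndec Rᵐᵒᵖ M ∧ ¬ Module.Projective Rᵐᵒᵖ M

/-- A right `S`-module `M`, viewed as a right `R`-module along `π : R →+* S`, is a
non-projective indecomposable Gorenstein projective right `R`-module. -/
def RestrIsNPIGProj {R S : Type} [Ring R] [Ring S] (π : R →+* S) (M : Type)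
    [AddCommGroup M] [Module Sᵐᵒᵖ M] : Prop :=
  letI := modRestrict π M
  IsNPIGProj R M

/-- The submodule `M·(RεR)` of a right `R`-module `M`;  the quotient
`M ⧸ M·(RεR)` realizes the tensor product `M ⊗_R R/RεR`. -/
def smulIdeal (R : Type) [Ring R] (ε : R) (M : Type) [AddCommGroup M]
    [Module Rᵐᵒᵖ M] : Submodule Rᵐᵒᵖ M :=
  Submodule.span Rᵐᵒᵖ {m | ∃ (x : M) (a b : R), m = (op (a * ε * b)) • x}

/-- `S` has finitely many finitely generated indecomposable modules up to
isomorphism.  (Applied with `S = Aᵐᵒᵖ` this says `A` is representation-finite.) -/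
def RepFinite (S : Type) [Ring S] : Prop :=
  ∃ (n : ℕ) (M : Fin n → ModuleCat.{0} S), ∀ N : ModuleCat.{0} S,
    Module.Finite S N → IsIndec S N → ∃ i, Nonempty (N ≃ₗ[S] M i)

/-- A cycle in the underlying undirected graph of `Q`:  a closed walk of
length ≥ 1 along edges (each traversed forwards or backwards) with pairwise
distinct vertices and pairwise distinct edges. -/
structure UCycle (Q : QuiverData) where
  len : ℕ
  len1 : 1 ≤ len
  edges : ℕ → Fin Q.nE
  dir : ℕ → Bool
  vert : ℕ → Fin Q.nV
  pe : ∀ i, edges (i + len) = edges i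
  pd : ∀ i, dir (i + len) = dir i
  pv : ∀ i, vert (i + len) = vert i
  incid_t : ∀ i, dir i = true →
    Q.src (edges i) = vert i ∧ Q.tgt (edges i) = vert (i + 1)
  incid_f : ∀ i, dir i = false →
    Q.tgt (edges i) = vert i ∧ Q.src (edges i) = vert (i + 1)
  vdist : ∀ i j, i < len → j < len → vert i = vert j → i = j
  edist : ∀ i j, i < len → j < len → edges i = edges j → i = j

/-- The set of edges of an undirected cycle. -/
def UCycle.edgeSet {Q : QuiverData} (C : UCycle Q) : Set (Fin Q.nE) :=
  {e | ∃ i < C.len, C.edges i = e}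

/-- The underlying graph of `Q` has exactly one cycle. -/
def OneCycle (Q : QuiverData) : Prop :=
  Nonempty (UCycle Q) ∧ ∀ C C' : UCycle Q, C.edgeSet = C'.edgeSet

/-- The projective dimension of (the module underlying) `M` is at most `n`. -/
def projDimLE (S : Type) [Ring S] : ℕ → ModuleCat.{0} S → Prop
  | 0, M => Module.Projective S M
  | n + 1, M => ∃ (P : ModuleCat.{0} S) (f : P →ₗ[S] M), Module.Projective S P ∧
      Function.Surjective f ∧ projDimLE S n (ModuleCat.of S (LinearMap.ker f))

/-- The injective dimension of (the module underlying) `M` is at most `n`. -/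
def injDimLE (S : Type) [Ring S] : ℕ → ModuleCat.{0} S → Prop
  | 0, M => Module.Injective S M
  | n + 1, M => ∃ (J : ModuleCat.{0} S) (f : M →ₗ[S] J), Module.Injective S J ∧
      Function.Injective f ∧ injDimLE S n (ModuleCat.of S (J ⧸ LinearMap.range f))

end

/-! ### Generators of a bound quiver algebra -/

namespace GAlg

variable {k : Type} [Field k] {Q : QuiverData} {Rel : Set (Fin Q.nE × Fin Q.nE)}

lemma vtx_mul_vtx (v w : Fin Q.nV) :
    vtx k Q v * vtx k Q w = if v = w then vtx k Q v else 0 := by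
  have h := RingQuot.mkAlgHom_rel k (PathRel.vtx_mul (k := k) v w)
  rw [map_mul] at h
  refine Eq.trans h ?_
  split_ifs
  · rfl
  · exact map_zero _

lemma sum_vtx : ∑ v, vtx k Q v = 1 := by
  have h := RingQuot.mkAlgHom_rel k (PathRel.vtx_sum (k := k) (Q := Q))
  rw [map_sum, map_one] at h
  exact h

lemma vtx_src_mul_arr (a : Fin Q.nE) : vtx k Q (Q.src a) * arr k Q a = arr k Q a := by
  have h := RingQuot.mkAlgHom_rel k (PathRel.src_arr (k := k) a)
  rw [map_mul] at h
  exact h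

lemma arr_mul_vtx_tgt (a : Fin Q.nE) : arr k Q a * vtx k Q (Q.tgt a) = arr k Q a := by
  have h := RingQuot.mkAlgHom_rel k (PathRel.arr_tgt (k := k) a)
  rw [map_mul] at h
  exact h

lemma vtxA_mul_vtxA (v w : Fin Q.nV) :
    vtxA k Q Rel v * vtxA k Q Rel w = if v = w then vtxA k Q Rel v else 0 := by
  rw [vtxA, vtxA, ← map_mul, vtx_mul_vtx]
  split_ifs
  · rfl
  · exact map_zero _

lemma vtxA_mul_self (v : Fin Q.nV) : vtxA k Q Rel v * vtxA k Q Rel v = vtxA k Q Rel v := by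
  rw [vtxA_mul_vtxA, if_pos rfl]

lemma sum_vtxA : ∑ v, vtxA k Q Rel v = 1 := by
  simp only [vtxA]
  rw [← map_sum, sum_vtx, map_one]

lemma vtxA_src_mul_arrA (a : Fin Q.nE) :
    vtxA k Q Rel (Q.src a) * arrA k Q Rel a = arrA k Q Rel a := by
  rw [vtxA, arrA, ← map_mul, vtx_src_mul_arr]

lemma arrA_mul_vtxA_tgt (a : Fin Q.nE) :
    arrA k Q Rel a * vtxA k Q Rel (Q.tgt a) = arrA k Q Rel a := by
  rw [vtxA, arrA, ← map_mul, arr_mul_vtx_tgt]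

lemma vtxA_mul_arrA (v : Fin Q.nV) (a : Fin Q.nE) :
    vtxA k Q Rel v * arrA k Q Rel a = if Q.src a = v then arrA k Q Rel a else 0 := by
  rw [← vtxA_src_mul_arrA, ← mul_assoc, vtxA_mul_vtxA]
  by_cases h : Q.src a = v
  · subst h; simp
  · rw [if_neg h, if_neg (Ne.symm h), zero_mul]

lemma arrA_mul_vtxA (a : Fin Q.nE) (v : Fin Q.nV) :
    arrA k Q Rel a * vtxA k Q Rel v = if Q.tgt a = v then arrA k Q Rel a else 0 := by
  rw [← arrA_mul_vtxA_tgt, mul_assoc, vtxA_mul_vtxA]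
  by_cases h : Q.tgt a = v
  · subst h; simp
  · rw [if_neg h, if_neg h, mul_zero]

lemma arrA_mul_arrA_of_ne {a b : Fin Q.nE} (h : Q.tgt a ≠ Q.src b) :
    arrA k Q Rel a * arrA k Q Rel b = 0 := by
  rw [← vtxA_src_mul_arrA b, ← mul_assoc, arrA_mul_vtxA, if_neg h, zero_mul]

lemma inI_arr_mul_arr_iff {a b : Fin Q.nE} :
    inI k Q Rel (arr k Q a * arr k Q b) ↔ arrA k Q Rel a * arrA k Q Rel b = 0 := by
  rw [inI, map_mul]; rfl

lemma arrA_mul_arrA_of_rel {a b : Fin Q.nE} (h : (a, b) ∈ Rel) :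
    arrA k Q Rel a * arrA k Q Rel b = 0 := by
  have h := RingQuot.mkAlgHom_rel k (s := GRel k Q Rel) ⟨⟨(a, b), h, rfl⟩, rfl⟩
  rw [map_mul, map_zero] at h
  exact h

lemma gmap_surjective : Function.Surjective (gmap k Q Rel) :=
  RingQuot.mkAlgHom_surjective k _

@[elab_as_elim]
lemma induction_on {motive : GAlg k Q Rel → Prop} (x : GAlg k Q Rel)
    (scalar : ∀ c : k, motive (algebraMap k _ c))
    (vtx : ∀ v, motive (vtxA k Q Rel v)) (arr : ∀ a, motive (arrA k Q Rel a))
    (add : ∀ x y, motive x → motive y → motive (x + y))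
    (mul : ∀ x y, motive x → motive y → motive (x * y)) : motive x := by
  obtain ⟨y, rfl⟩ := gmap_surjective x
  let p : FreeAlgebra k (Fin Q.nV ⊕ Fin Q.nE) →ₐ[k] PathAlg k Q :=
    RingQuot.mkAlgHom k (PathRel k Q)
  obtain ⟨z, rfl⟩ : ∃ z, p z = y := RingQuot.mkAlgHom_surjective k (PathRel k Q) y
  induction z using FreeAlgebra.induction with
  | grade0 r => simpa using scalar r
  | grade1 x => cases x with
    | inl v => exact vtx v
    | inr a => exact arr a
  | mul a b ha hb => rw [map_mul, map_mul]; exact mul _ _ ha hb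
  | add a b ha hb => rw [map_add, map_add]; exact add _ _ ha hb

/-- The universal property of the bound quiver algebra. -/
lemma exists_lift {B : Type} [Ring B] [Algebra k B] (ev : Fin Q.nV → B) (ar : Fin Q.nE → B)
    (hvv : ∀ v w, ev v * ev w = if v = w then ev v else 0) (hsum : ∑ v, ev v = 1)
    (hsrc : ∀ a, ev (Q.src a) * ar a = ar a) (htgt : ∀ a, ar a * ev (Q.tgt a) = ar a)
    (hrel : ∀ a b, (a, b) ∈ Rel → ar a * ar b = 0) :
    ∃ Φ : GAlg k Q Rel →ₐ[k] B,
      (∀ v, Φ (vtxA k Q Rel v) = ev v) ∧ ∀ a, Φ (arrA k Q Rel a) = ar a := by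
  let F : FreeAlgebra k (Fin Q.nV ⊕ Fin Q.nE) →ₐ[k] B := FreeAlgebra.lift k (Sum.elim ev ar)
  have hF : ∀ ⦃x y⦄, PathRel k Q x y → F x = F y := by
    intro x y h
    induction h with
    | vtx_mul v w =>
      have := hvv v w
      split_ifs at this ⊢ <;> simpa [F] using this
    | vtx_sum => simpa [F] using hsum
    | src_arr e => simpa [F] using hsrc e
    | arr_tgt e => simpa [F] using htgt e
  let G : PathAlg k Q →ₐ[k] B := RingQuot.liftAlgHom k ⟨F, hF⟩
  have hGv : ∀ v, G (vtx k Q v) = ev v := fun v => by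
    refine (RingQuot.liftAlgHom_mkAlgHom_apply k F hF _).trans ?_
    simp [F]
  have hGa : ∀ a, G (arr k Q a) = ar a := fun a => by
    refine (RingQuot.liftAlgHom_mkAlgHom_apply k F hF _).trans ?_
    simp [F]
  have hG : ∀ ⦃x y⦄, GRel k Q Rel x y → G x = G y := by
    rintro x y ⟨⟨p, hp, rfl⟩, rfl⟩
    rw [map_mul, map_zero, hGa, hGa, hrel _ _ hp]
  let H : GAlg k Q Rel →ₐ[k] B := RingQuot.liftAlgHom k ⟨G, hG⟩
  exact ⟨H, fun v => (RingQuot.liftAlgHom_mkAlgHom_apply k G hG _).trans (hGv v),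
    fun a => (RingQuot.liftAlgHom_mkAlgHom_apply k G hG _).trans (hGa a)⟩

lemma mul_mem_of_gen_right (N : Submodule k (GAlg k Q Rel))
    (hv : ∀ x ∈ N, ∀ v, x * vtxA k Q Rel v ∈ N) (ha : ∀ x ∈ N, ∀ a, x * arrA k Q Rel a ∈ N)
    {x : GAlg k Q Rel} (hx : x ∈ N) (y : GAlg k Q Rel) : x * y ∈ N := by
  induction y using induction_on generalizing x with
  | scalar c => rw [← Algebra.commutes, ← Algebra.smul_def]; exact N.smul_mem c hx
  | vtx v => exact hv x hx v
  | arr a => exact ha x hx a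
  | add y z hy hz => rw [mul_add]; exact N.add_mem (hy hx) (hz hx)
  | mul y z hy hz => rw [← mul_assoc]; exact hz (hy hx)

lemma mul_mem_of_gen_left (N : Submodule k (GAlg k Q Rel))
    (hv : ∀ x ∈ N, ∀ v, vtxA k Q Rel v * x ∈ N) (ha : ∀ x ∈ N, ∀ a, arrA k Q Rel a * x ∈ N)
    {x : GAlg k Q Rel} (hx : x ∈ N) (y : GAlg k Q Rel) : y * x ∈ N := by
  induction y using induction_on generalizing x with
  | scalar c => rw [← Algebra.smul_def]; exact N.smul_mem c hx
  | vtx v => exact hv x hx v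
  | arr a => exact ha x hx a
  | add y z hy hz => rw [add_mul]; exact N.add_mem (hy hx) (hz hx)
  | mul y z hy hz => rw [mul_assoc]; exact hy (hz hx)

/-- Every element is a combination of trivial paths plus an element of the arrow ideal. -/
lemma exists_eq_sum_add_sum (x : GAlg k Q Rel) :
    ∃ (c : Fin Q.nV → k) (y : Fin Q.nE → GAlg k Q Rel),
      x = ∑ v, c v • vtxA k Q Rel v + ∑ a, arrA k Q Rel a * y a := by
  classical
  let f : (Fin Q.nV → k) × (Fin Q.nE → GAlg k Q Rel) →ₗ[k] GAlg k Q Rel :=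
    LinearMap.coprod (∑ v, (LinearMap.proj v).smulRight (vtxA k Q Rel v))
      (∑ a, (LinearMap.mulLeft k (arrA k Q Rel a)).comp (LinearMap.proj a))
  have hf : ∀ p, f p = ∑ v, p.1 v • vtxA k Q Rel v + ∑ a, arrA k Q Rel a * p.2 a := by
    intro p; simp [f]
  have hfv : ∀ (c : k) v, c • vtxA k Q Rel v ∈ LinearMap.range f := fun c v =>
    ⟨(Pi.single v c, 0), by simp [hf, Pi.single_apply, ite_smul]⟩
  have hfa : ∀ a y, arrA k Q Rel a * y ∈ LinearMap.range f := fun a y =>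
    ⟨(0, Pi.single a y), by simp [hf, Pi.single_apply, mul_ite]⟩
  have h1 : (1 : GAlg k Q Rel) ∈ LinearMap.range f := by
    rw [← sum_vtxA]
    exact Submodule.sum_mem _ fun v _ => by simpa using hfv 1 v
  have key := mul_mem_of_gen_right (LinearMap.range f) ?_ ?_ h1 x
  · obtain ⟨p, hp⟩ := key
    exact ⟨p.1, p.2, by rw [← hf, hp, one_mul]⟩
  · rintro _ ⟨p, rfl⟩ v
    rw [hf, add_mul, Finset.sum_mul, Finset.sum_mul]
    refine add_mem (Submodule.sum_mem _ fun w _ => ?_) (Submodule.sum_mem _ fun a _ => ?_)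
    · rw [smul_mul_assoc, vtxA_mul_vtxA]
      split_ifs
      · exact hfv _ _
      · simp
    · rw [mul_assoc]; exact hfa _ _
  · rintro _ ⟨p, rfl⟩ b
    rw [hf, add_mul, Finset.sum_mul, Finset.sum_mul]
    refine add_mem (Submodule.sum_mem _ fun w _ => ?_) (Submodule.sum_mem _ fun a _ => ?_)
    · rw [smul_mul_assoc, vtxA_mul_arrA]
      split_ifs
      · have h := hfa b (algebraMap k _ (p.1 w))
        rwa [← Algebra.commutes, ← Algebra.smul_def] at h
      · simp
    · rw [mul_assoc]; exact hfa _ _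

lemma exists_vtxA_mul_eq (v : Fin Q.nV) (x : GAlg k Q Rel) :
    ∃ (c : k) (y : Fin Q.nE → GAlg k Q Rel), vtxA k Q Rel v * x =
      c • vtxA k Q Rel v + ∑ a with Q.src a = v, arrA k Q Rel a * y a := by
  classical
  obtain ⟨c, y, rfl⟩ := exists_eq_sum_add_sum x
  refine ⟨c v, y, ?_⟩
  rw [mul_add, Finset.mul_sum, Finset.mul_sum, Finset.sum_filter]
  congr 1
  · simp [vtxA_mul_vtxA]
  · refine Finset.sum_congr rfl fun a _ => ?_
    rw [← mul_assoc, vtxA_mul_arrA]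
    split_ifs <;> simp

end GAlg

/-! ### Nilpotency of the arrow ideal -/

namespace GAlg

variable {k : Type} [Field k] {Q : QuiverData} {Rel : Set (Fin Q.nE × Fin Q.nE)}

/-- The right ideal generated by the products of `n` arrows. -/
def arrowPow (k : Type) [Field k] (Q : QuiverData) (Rel : Set (Fin Q.nE × Fin Q.nE)) (n : ℕ) :
    Submodule k (GAlg k Q Rel) :=
  Submodule.span k {z | ∃ (l : List (Fin Q.nE)) (y : GAlg k Q Rel), l.length = n ∧
    z = (l.map (arrA k Q Rel)).prod * y}

lemma arrA_mul_mem_arrowPow {n : ℕ} (a : Fin Q.nE) {z : GAlg k Q Rel}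
    (hz : z ∈ arrowPow k Q Rel n) : arrA k Q Rel a * z ∈ arrowPow k Q Rel (n + 1) := by
  induction hz using Submodule.span_induction with
  | mem z hz =>
    obtain ⟨l, y, hl, rfl⟩ := hz
    exact Submodule.subset_span ⟨a :: l, y, by simp [hl], by simp [mul_assoc]⟩
  | zero => simp
  | add x y _ _ hx hy => rw [mul_add]; exact add_mem hx hy
  | smul c x _ hx => rw [mul_smul_comm]; exact Submodule.smul_mem _ _ hx

lemma arrowPow_succ_le (n : ℕ) : arrowPow k Q Rel (n + 1) ≤ arrowPow k Q Rel n := by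
  refine Submodule.span_le.2 ?_
  rintro _ ⟨l, y, hl, rfl⟩
  refine Submodule.subset_span
    ⟨l.take n, ((l.drop n).map (arrA k Q Rel)).prod * y, by simp [hl], ?_⟩
  rw [← mul_assoc, ← List.prod_append, ← List.map_append, List.take_append_drop]

lemma mul_mem_arrowPow {n : ℕ} (y : GAlg k Q Rel) {z : GAlg k Q Rel}
    (hz : z ∈ arrowPow k Q Rel n) : y * z ∈ arrowPow k Q Rel n := by
  refine mul_mem_of_gen_left _ (fun x hx v => ?_)
    (fun x hx a => arrowPow_succ_le n (arrA_mul_mem_arrowPow a hx)) hz y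
  induction hx using Submodule.span_induction with
  | mem z hz =>
    obtain ⟨l, y, hl, rfl⟩ := hz
    cases l with
    | nil => exact Submodule.subset_span ⟨[], vtxA k Q Rel v * y, hl, by simp⟩
    | cons a l =>
      rw [List.map_cons, List.prod_cons, ← mul_assoc, ← mul_assoc, vtxA_mul_arrA]
      split_ifs
      · exact Submodule.subset_span ⟨a :: l, y, hl, by simp⟩
      · simp
  | zero => simp
  | add x y _ _ hx hy => rw [mul_add]; exact add_mem hx hy
  | smul c x _ hx => rw [mul_smul_comm]; exact Submodule.smul_mem _ _ hx

lemma _root_.IsGentle.exists_prod_eq_zero (h : IsGentle k Q Rel) :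
    ∃ m, ∀ l : List (Fin Q.nE), l.length = m → (l.map (arrA k Q Rel)).prod = 0 := by
  obtain ⟨m, -, hm⟩ := h.admissible
  refine ⟨m, ?_⟩
  rintro l rfl
  have := hm l.get
  rw [inI, map_list_prod, List.map_ofFn] at this
  rw [← this]
  congr 1
  conv_lhs => rw [← List.ofFn_get l, List.map_ofFn]
  rfl

lemma isNilpotent_sum_arrA_mul (h : IsGentle k Q Rel) (s : Finset (Fin Q.nE))
    (y : Fin Q.nE → GAlg k Q Rel) : IsNilpotent (∑ a ∈ s, arrA k Q Rel a * y a) := by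
  obtain ⟨m, hm⟩ := h.exists_prod_eq_zero
  have key : ∀ n, (∑ a ∈ s, arrA k Q Rel a * y a) ^ n ∈ arrowPow k Q Rel n := by
    intro n
    induction n with
    | zero => exact Submodule.subset_span ⟨[], 1, rfl, by simp⟩
    | succ n ih =>
      rw [pow_succ', Finset.sum_mul]
      refine Submodule.sum_mem _ fun a _ => ?_
      rw [mul_assoc]
      exact arrA_mul_mem_arrowPow a (mul_mem_arrowPow _ ih)
  have h0 : arrowPow k Q Rel m = ⊥ := by
    refine Submodule.span_eq_bot.2 ?_
    rintro _ ⟨l, y, hl, rfl⟩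
    rw [hm l hl, zero_mul]
  exact ⟨m, by simpa [h0] using key m⟩

end GAlg

/-! ### Right modules -/

section RightModule

variable {R : Type} [Ring R] {M : Type} [AddCommGroup M] [Module Rᵐᵒᵖ M]

/-- The map `R → M`, `x ↦ m · x`, of right `R`-modules. -/
def orbitMap (m : M) : R →ₗ[Rᵐᵒᵖ] M where
  toFun x := op x • m
  map_add' x y := by rw [op_add, add_smul]
  map_smul' c x := by
    induction c using MulOpposite.rec'
    rw [op_smul_eq_mul, op_mul, mul_smul, RingHom.id_apply]

lemma orbitMap_apply (m : M) (x : R) : orbitMap m x = op x • m := rfl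

lemma mem_rIdeal {x z : R} : z ∈ rIdeal R x ↔ ∃ y, z = x * y := by
  rw [rIdeal, Submodule.mem_span_singleton]
  constructor
  · rintro ⟨c, rfl⟩; exact ⟨c.unop, rfl⟩
  · rintro ⟨y, rfl⟩; exact ⟨op y, rfl⟩

lemma mul_mem_right (N : Submodule Rᵐᵒᵖ R) {x : R} (hx : x ∈ N) (y : R) : x * y ∈ N :=
  N.smul_mem (op y) hx

end RightModule

/-! ### Annihilators of arrows -/

namespace GAlg

variable {k : Type} [Field k] {Q : QuiverData} {Rel : Set (Fin Q.nE × Fin Q.nE)}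

/-- The right ideal generated by `1 - ε_v` and the arrows in `B`. -/
def vIdeal (k : Type) [Field k] (Q : QuiverData) (Rel : Set (Fin Q.nE × Fin Q.nE))
    (v : Fin Q.nV) (B : Set (Fin Q.nE)) : Submodule (GAlg k Q Rel)ᵐᵒᵖ (GAlg k Q Rel) :=
  Submodule.span _ (insert (1 - vtxA k Q Rel v) (arrA k Q Rel '' B))

/-- The set of arrows `c` with `bc` one of the generating relations. -/
def relSucc (Rel : Set (Fin Q.nE × Fin Q.nE)) (b : Fin Q.nE) : Set (Fin Q.nE) :=
  {c | (b, c) ∈ Rel}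

lemma one_sub_vtxA_mem_vIdeal (v : Fin Q.nV) (B : Set (Fin Q.nE)) :
    1 - vtxA k Q Rel v ∈ vIdeal k Q Rel v B :=
  Submodule.subset_span (Set.mem_insert _ _)

lemma arrA_mem_vIdeal (v : Fin Q.nV) {B : Set (Fin Q.nE)} {a : Fin Q.nE} (ha : a ∈ B) :
    arrA k Q Rel a ∈ vIdeal k Q Rel v B :=
  Submodule.subset_span (Set.mem_insert_of_mem _ ⟨a, ha, rfl⟩)

lemma mul_eq_zero_of_mem_vIdeal {b : Fin Q.nE} {x : GAlg k Q Rel}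
    (hx : x ∈ vIdeal k Q Rel (Q.tgt b) (relSucc Rel b)) : arrA k Q Rel b * x = 0 := by
  induction hx using Submodule.span_induction with
  | mem x hx =>
    rcases hx with rfl | ⟨c, hc, rfl⟩
    · rw [mul_sub, mul_one, arrA_mul_vtxA_tgt, sub_self]
    · exact arrA_mul_arrA_of_rel hc
  | zero => simp
  | add x y _ _ hx hy => rw [mul_add, hx, hy, add_zero]
  | smul c x _ hx =>
    induction c using MulOpposite.rec'
    rw [op_smul_eq_mul, ← mul_assoc, hx, zero_mul]

/-- The right annihilator of an arrow is generated by the relations, and the right ideals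
generated by distinct arrows are independent. -/
lemma mem_vIdeal_of_sum_eq_zero (x : Fin Q.nE → GAlg k Q Rel)
    (hx : ∑ a, arrA k Q Rel a * x a = 0) (b : Fin Q.nE) :
    x b ∈ vIdeal k Q Rel (Q.tgt b) (relSucc Rel b) := by
  classical
  set I := vIdeal k Q Rel (Q.tgt b) (relSucc Rel b) with hI
  let N : Submodule k (GAlg k Q Rel) :=
    { carrier := I
      add_mem' := I.add_mem
      zero_mem' := I.zero_mem
      smul_mem' := fun c y hy => by
        rw [Algebra.smul_def, Algebra.commutes]; exact mul_mem_right I hy _ }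
  have hNI : ∀ {y}, y ∈ N ↔ y ∈ I := Iff.rfl
  let ρ : GAlg k Q Rel → (GAlg k Q Rel ⧸ N) →ₗ[k] (GAlg k Q Rel ⧸ N) := fun y =>
    N.mapQ N (LinearMap.mulRight k y) fun z hz => mul_mem_right I hz y
  have hρ : ∀ y z, ρ y (N.mkQ z) = N.mkQ (z * y) := fun y z => rfl
  have hone : N.mkQ (vtxA k Q Rel (Q.tgt b)) = N.mkQ 1 := by
    rw [eq_comm, ← sub_eq_zero, ← map_sub, Submodule.mkQ_apply, Submodule.Quotient.mk_eq_zero]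
    exact one_sub_vtxA_mem_vIdeal _ _
  have hrel : ∀ c, (b, c) ∈ Rel → N.mkQ (arrA k Q Rel c) = 0 := fun c hc => by
    rw [Submodule.mkQ_apply, Submodule.Quotient.mk_eq_zero]
    exact arrA_mem_vIdeal _ hc
  let ar : Fin Q.nE → Module.End k (k × (GAlg k Q Rel ⧸ N)) := fun a => LinearMap.prod 0
    ((ρ (arrA k Q Rel a)).comp (LinearMap.snd k k _) +
      if a = b then (LinearMap.fst k k _).smulRight (N.mkQ 1) else 0)
  let ev : Fin Q.nV → Module.End k (k × (GAlg k Q Rel ⧸ N)) := fun v => LinearMap.prod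
    (if v = Q.src b then LinearMap.fst k k _ else 0)
    ((ρ (vtxA k Q Rel v)).comp (LinearMap.snd k k _))
  have har : ∀ a c z, ar a (c, N.mkQ z) =
      (0, N.mkQ (z * arrA k Q Rel a) + if a = b then c • N.mkQ 1 else 0) := by
    intro a c z
    simp only [ar]
    split_ifs <;> simp [← hρ]
  have hev : ∀ v c z, ev v (c, N.mkQ z) =
      (if v = Q.src b then c else 0, N.mkQ (z * vtxA k Q Rel v)) := by
    intro v c z
    simp only [ev]
    split_ifs <;> simp [← hρ]
  have hext : ∀ {f g : Module.End k (k × (GAlg k Q Rel ⧸ N))},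
      (∀ c z, f (c, N.mkQ z) = g (c, N.mkQ z)) → f = g := by
    intro f g h
    refine LinearMap.ext fun p => ?_
    obtain ⟨c, w⟩ := p
    obtain ⟨z, rfl⟩ := N.mkQ_surjective w
    exact h c z
  obtain ⟨Φ, hΦv, hΦa⟩ := exists_lift (k := k) (Q := Q) (Rel := Rel)
    (B := (Module.End k (k × (GAlg k Q Rel ⧸ N)))ᵐᵒᵖ) (fun v => op (ev v)) (fun a => op (ar a))
    (fun v w => by
      rw [← op_mul]
      trans op (if v = w then ev v else 0)
      · congr 1
        refine hext fun c z => ?_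
        rw [Module.End.mul_apply, hev, hev, mul_assoc, vtxA_mul_vtxA]
        by_cases hvw : v = w
        · subst hvw
          simp only [if_true, hev]
          split_ifs <;> rfl
        · have : ¬ (w = Q.src b ∧ v = Q.src b) := fun h => hvw (h.2.trans h.1.symm)
          simp only [hvw, if_false, mul_zero, map_zero, LinearMap.zero_apply]
          ext1
          · simp only; split_ifs <;> simp_all
          · rfl
      · split_ifs <;> rfl)
    (by
      rw [← Finset.op_sum, ← op_one]
      congr 1
      refine hext fun c z => ?_
      rw [LinearMap.sum_apply]
      simp only [hev]
      ext1
      · rw [Prod.fst_sum]; simp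
      · rw [Prod.snd_sum, ← map_sum, ← Finset.mul_sum, sum_vtxA, mul_one]; rfl)
    (fun a => by
      rw [← op_mul]
      congr 1
      refine hext fun c z => ?_
      rw [Module.End.mul_apply, hev, har, har, mul_assoc, vtxA_src_mul_arrA]
      by_cases hab : a = b
      · subst hab; simp
      · simp [hab])
    (fun a => by
      rw [← op_mul]
      congr 1
      refine hext fun c z => ?_
      rw [Module.End.mul_apply, har]
      by_cases hab : a = b
      · subst hab
        rw [if_pos rfl, ← map_smul, ← map_add, hev, add_mul, mul_assoc, arrA_mul_vtxA_tgt,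
          smul_mul_assoc, one_mul, map_add, map_smul, hone, map_add, map_smul]
        simp
      · rw [if_neg hab, add_zero, hev, mul_assoc, arrA_mul_vtxA_tgt]
        simp)
    (fun a a' h => by
      rw [← op_mul, ← op_zero]
      congr 1
      refine hext fun c z => ?_
      rw [Module.End.mul_apply, har]
      by_cases hab : a = b
      · subst hab
        rw [if_pos rfl, ← map_smul, ← map_add, har, add_mul, mul_assoc, arrA_mul_arrA_of_rel h,
          smul_mul_assoc, one_mul, map_add, map_smul, hrel _ h]
        simp
      · rw [if_neg hab, add_zero, har, mul_assoc, arrA_mul_arrA_of_rel h]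
        simp)
  have hΦ : ∀ y z, (Φ y).unop (0, N.mkQ z) = (0, N.mkQ (z * y)) := by
    intro y
    induction y using induction_on with
    | scalar c =>
      intro z
      rw [AlgHom.commutes, MulOpposite.algebraMap_apply, unop_op, Module.algebraMap_end_apply,
        ← Algebra.commutes, ← Algebra.smul_def, map_smul]
      simp
    | vtx v => intro z; rw [hΦv, unop_op, hev]; simp
    | arr a => intro z; rw [hΦa, unop_op, har]; simp
    | add x y hx hy =>
      intro z
      rw [map_add, unop_add, LinearMap.add_apply, hx, hy, mul_add, map_add]
      simp
    | mul x y hx hy =>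
      intro z
      rw [map_mul, unop_mul, Module.End.mul_apply, hx, hy, mul_assoc]
  have key : ∀ a y, (Φ (arrA k Q Rel a * y)).unop (1, 0) =
      if a = b then (0, N.mkQ y) else 0 := by
    intro a y
    rw [map_mul, unop_mul, Module.End.mul_apply, hΦa, unop_op, ← map_zero N.mkQ, har]
    split_ifs
    · rw [zero_mul, map_zero, zero_add, one_smul, hΦ, one_mul]
    · rw [zero_mul, add_zero, hΦ, zero_mul, map_zero]; rfl
  have h0 := congrArg (fun y => (Φ y).unop (1, 0)) hx
  simp only [map_sum, Finset.unop_sum, LinearMap.sum_apply, key, map_zero, unop_zero,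
    LinearMap.zero_apply, Finset.sum_ite_eq', Finset.mem_univ, if_true] at h0
  have h1 : N.mkQ (x b) = 0 := congrArg Prod.snd h0
  rwa [Submodule.mkQ_apply, Submodule.Quotient.mk_eq_zero] at h1

lemma arrA_mul_eq_zero_iff {b : Fin Q.nE} {x : GAlg k Q Rel} :
    arrA k Q Rel b * x = 0 ↔ x ∈ vIdeal k Q Rel (Q.tgt b) (relSucc Rel b) := by
  classical
  refine ⟨fun h => ?_, mul_eq_zero_of_mem_vIdeal⟩
  have := mem_vIdeal_of_sum_eq_zero (Pi.single b x) ?_ b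
  · simpa using this
  · rw [Finset.sum_eq_single b]
    · simpa using h
    · intro a _ ha; simp [Pi.single_eq_of_ne ha]
    · simp

end GAlg

/-! ### Modules for which a complex of projectives stays exact under `Hom` -/

section HomExact

variable {S : Type} [Ring S]

/-- The sequence `Hom(P, Y)` is exact. -/
def HomExact (P : ℤ → ModuleCat.{0} S) (d : (n : ℤ) → (P n →ₗ[S] P (n + 1)))
    (Y : Type) [AddCommGroup Y] [Module S Y] : Prop :=
  ∀ (n : ℤ) (g : P (n + 1) →ₗ[S] Y), g.comp (d n) = 0 →
    ∃ h : P (n + 1 + 1) →ₗ[S] Y, h.comp (d (n + 1)) = g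

variable {P : ℤ → ModuleCat.{0} S} {d : (n : ℤ) → (P n →ₗ[S] P (n + 1))}
  {Y F K : Type} [AddCommGroup Y] [Module S Y] [AddCommGroup F] [Module S F]
  [AddCommGroup K] [Module S K]

lemma HomExact.retract (hF : HomExact P d F) (i : Y →ₗ[S] F) (r : F →ₗ[S] Y)
    (hri : ∀ y, r (i y) = y) : HomExact P d Y := by
  intro n g hg
  obtain ⟨h, hh⟩ := hF n (i.comp g) (by rw [LinearMap.comp_assoc, hg, LinearMap.comp_zero])
  refine ⟨r.comp h, ?_⟩
  rw [LinearMap.comp_assoc, hh]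
  ext x
  simp [hri]

lemma HomExact.prod (hF : HomExact P d F) (hK : HomExact P d K) : HomExact P d (F × K) := by
  intro n g hg
  obtain ⟨h₁, hh₁⟩ := hF n ((LinearMap.fst S F K).comp g)
    (by rw [LinearMap.comp_assoc, hg, LinearMap.comp_zero])
  obtain ⟨h₂, hh₂⟩ := hK n ((LinearMap.snd S F K).comp g)
    (by rw [LinearMap.comp_assoc, hg, LinearMap.comp_zero])
  refine ⟨h₁.prod h₂, LinearMap.ext fun x => Prod.ext ?_ ?_⟩
  · exact LinearMap.congr_fun hh₁ x
  · exact LinearMap.congr_fun hh₂ x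

lemma HomExact.pi {ι : Type} {Z : ι → Type} [∀ i, AddCommGroup (Z i)] [∀ i, Module S (Z i)]
    (hZ : ∀ i, HomExact P d (Z i)) : HomExact P d (∀ i, Z i) := by
  intro n g hg
  choose h hh using fun i => hZ i n ((LinearMap.proj i).comp g)
    (by rw [LinearMap.comp_assoc, hg, LinearMap.comp_zero])
  exact ⟨LinearMap.pi h, LinearMap.ext fun x => funext fun i => LinearMap.congr_fun (hh i) x⟩

/-- The cokernel of an injection between modules with `Hom(P, -)` exact has the same property. -/
lemma HomExact.of_exact (hP : ∀ n, Module.Projective S (P n))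
    (hd : ∀ n, (d (n + 1)).comp (d n) = 0)
    (hF : HomExact P d F) (hK : HomExact P d K) (i : K →ₗ[S] F) (p : F →ₗ[S] Y)
    (hi : Function.Injective i) (hp : Function.Surjective p)
    (hip : LinearMap.range i = LinearMap.ker p) : HomExact P d Y := by
  intro n g hg
  obtain ⟨n, rfl⟩ : ∃ m, n = m + 1 := ⟨n - 1, by ring⟩
  obtain ⟨g', hg'⟩ := Module.projective_lifting_property p g hp
  have hmem : ∀ x, g' (d (n + 1) x) ∈ LinearMap.range i := fun x => by
    rw [hip, LinearMap.mem_ker]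
    exact (LinearMap.congr_fun hg' _).trans (LinearMap.congr_fun hg x)
  let e := LinearEquiv.ofInjective i hi
  let u : P (n + 1) →ₗ[S] K :=
    e.symm.toLinearMap.comp ((g'.comp (d (n + 1))).codRestrict _ hmem)
  have hu : ∀ x, i (u x) = g' (d (n + 1) x) := fun x =>
    congrArg Subtype.val (e.apply_symm_apply _)
  obtain ⟨h, hh⟩ := hK n u (by
    ext x
    apply hi
    rw [LinearMap.comp_apply, hu, ← LinearMap.comp_apply (d (n + 1)), hd]
    simp)
  obtain ⟨h', hh'⟩ := hF (n + 1) (g' - i.comp h) (by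
    ext x
    rw [LinearMap.comp_apply, LinearMap.sub_apply, LinearMap.comp_apply,
      ← LinearMap.comp_apply h, hh, hu, sub_self, LinearMap.zero_apply])
  refine ⟨p.comp h', ?_⟩
  rw [LinearMap.comp_assoc, hh']
  ext x
  have h0 : p (i (h x)) = 0 := by
    rw [← LinearMap.mem_ker, ← hip]; exact LinearMap.mem_range_self _ _
  rw [LinearMap.comp_apply, LinearMap.sub_apply, map_sub, LinearMap.comp_apply, h0, sub_zero]
  exact LinearMap.congr_fun hg' x

/-- Every map from the image of a differential to a module with `Hom(P, -)` exact factors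
through any surjection onto that module. -/
lemma HomExact.exists_lift (hP : ∀ n, Module.Projective S (P n))
    (hd : ∀ n, (d (n + 1)).comp (d n) = 0) (hY : HomExact P d Y) {M : Type} [AddCommGroup M]
    [Module S M] (n : ℤ) (e : M ≃ₗ[S] LinearMap.range (d n)) (f : M →ₗ[S] Y) (p : F →ₗ[S] Y)
    (hp : Function.Surjective p) : ∃ g : M →ₗ[S] F, p.comp g = f := by
  obtain ⟨n, rfl⟩ : ∃ m, n = m + 1 := ⟨n - 1, by ring⟩
  obtain ⟨h, hh⟩ := hY n ((f.comp e.symm.toLinearMap).comp (d (n + 1)).rangeRestrict) (by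
    ext x
    have : (d (n + 1)).rangeRestrict (d n x) = 0 := Subtype.ext (LinearMap.congr_fun (hd n) x)
    rw [LinearMap.comp_apply, LinearMap.comp_apply, this]
    simp)
  obtain ⟨h', hh'⟩ := Module.projective_lifting_property p h hp
  refine ⟨h'.comp ((LinearMap.range (d (n + 1))).subtype.comp e.toLinearMap), ?_⟩
  rw [← LinearMap.comp_assoc, hh']
  ext m
  obtain ⟨x, hx⟩ := (d (n + 1)).surjective_rangeRestrict (e m)
  have h1 : h (d (n + 1) x) = f (e.symm ((d (n + 1)).rangeRestrict x)) :=
    LinearMap.congr_fun hh x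
  have h2 : d (n + 1) x = e m := congrArg Subtype.val hx
  rw [hx, e.symm_apply_apply, h2] at h1
  exact h1

end HomExact

namespace GAlg

variable {k : Type} [Field k] {Q : QuiverData} {Rel : Set (Fin Q.nE × Fin Q.nE)}
  {P : ℤ → ModuleCat.{0} (GAlg k Q Rel)ᵐᵒᵖ}
  {d : (n : ℤ) → (P n →ₗ[(GAlg k Q Rel)ᵐᵒᵖ] P (n + 1))}

lemma homExact_of_ker_eq_vIdeal (hP : ∀ n, Module.Projective (GAlg k Q Rel)ᵐᵒᵖ (P n))
    (hd : ∀ n, (d (n + 1)).comp (d n) = 0) (hA : HomExact P d (GAlg k Q Rel))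
    (v : Fin Q.nV) (B : Set (Fin Q.nE)) (hB : ∀ b ∈ B, Q.src b = v)
    (hBe : ∀ b ∈ B, HomExact P d (rIdeal (GAlg k Q Rel) (arrA k Q Rel b)))
    {Y : Type} [AddCommGroup Y] [Module (GAlg k Q Rel)ᵐᵒᵖ Y]
    (p : GAlg k Q Rel →ₗ[(GAlg k Q Rel)ᵐᵒᵖ] Y) (hp : Function.Surjective p)
    (hker : LinearMap.ker p = vIdeal k Q Rel v B) : HomExact P d Y := by
  classical
  have hidem : (1 - vtxA k Q Rel v) * (1 - vtxA k Q Rel v) = 1 - vtxA k Q Rel v := by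
    rw [mul_sub, sub_mul, sub_mul, vtxA_mul_self]; simp
  have hvv : vtxA k Q Rel v * (1 - vtxA k Q Rel v) = 0 := by
    rw [mul_sub, mul_one, vtxA_mul_self, sub_self]
  have hE : HomExact P d (rIdeal (GAlg k Q Rel) (1 - vtxA k Q Rel v)) := by
    refine hA.retract (Submodule.subtype _)
      ((orbitMap (1 - vtxA k Q Rel v)).codRestrict _ fun x => mem_rIdeal.2 ⟨x, rfl⟩) ?_
    rintro ⟨y, hy⟩
    obtain ⟨x, rfl⟩ := mem_rIdeal.1 hy
    refine Subtype.ext ?_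
    simp [orbitMap_apply, ← mul_assoc, hidem]
  have hK := hE.prod (HomExact.pi (fun b : B => hBe b b.2))
  let i : (rIdeal (GAlg k Q Rel) (1 - vtxA k Q Rel v) ×
      ∀ b : B, rIdeal (GAlg k Q Rel) (arrA k Q Rel b)) →ₗ[(GAlg k Q Rel)ᵐᵒᵖ] GAlg k Q Rel :=
    LinearMap.coprod (Submodule.subtype _)
      (∑ b : B, (Submodule.subtype _).comp (LinearMap.proj b))
  have hi : ∀ z, i z = z.1 + ∑ b : B, (z.2 b : GAlg k Q Rel) := fun z => by simp [i]
  refine HomExact.of_exact hP hd hA hK i p ?_ hp ?_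
  · rw [← LinearMap.ker_eq_bot, LinearMap.ker_eq_bot']
    rintro ⟨⟨u, hu⟩, f⟩ h0
    obtain ⟨y, rfl⟩ := mem_rIdeal.1 hu
    choose x hx using fun b : B => mem_rIdeal.1 (f b).2
    rw [hi] at h0
    simp only [hx] at h0
    have hsum : ∑ b : B, arrA k Q Rel b * x b = 0 := by
      have h1 := congrArg (fun z => vtxA k Q Rel v * z) h0
      simp only [mul_add, ← mul_assoc, hvv, zero_mul, zero_add, Finset.mul_sum, mul_zero,
        vtxA_mul_arrA] at h1
      rw [← h1]
      exact Finset.sum_congr rfl fun b _ => by rw [if_pos (hB b b.2)]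
    rw [hsum, add_zero] at h0
    let x' : Fin Q.nE → GAlg k Q Rel := fun a => if h : a ∈ B then x ⟨a, h⟩ else 0
    have hsum' : ∑ a, arrA k Q Rel a * x' a = 0 := by
      rw [← hsum, ← Finset.sum_subset (Finset.filter_subset (· ∈ B) Finset.univ)
        (fun a _ ha => by simp [x', show a ∉ B by simpa using ha]),
        Finset.sum_subtype (p := (· ∈ B)) _ (by simp)]
      exact Finset.sum_congr rfl fun b _ => by simp [x']
    have hfb : ∀ b : B, f b = 0 := fun b => by
      have := mul_eq_zero_of_mem_vIdeal (mem_vIdeal_of_sum_eq_zero x' hsum' b)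
      refine Subtype.ext ?_
      rw [hx]
      simpa [x'] using this
    exact Prod.ext (Subtype.ext h0) (funext hfb)
  · rw [hker]
    apply le_antisymm
    · rintro _ ⟨z, rfl⟩
      rw [hi]
      refine add_mem ?_ (Submodule.sum_mem _ fun b _ => ?_)
      · obtain ⟨y, hy⟩ := mem_rIdeal.1 z.1.2
        rw [hy]
        exact mul_mem_right _ (one_sub_vtxA_mem_vIdeal _ _) _
      · obtain ⟨y, hy⟩ := mem_rIdeal.1 (z.2 b).2
        rw [hy]
        exact mul_mem_right _ (arrA_mem_vIdeal _ b.2) _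
    · refine Submodule.span_le.2 (Set.insert_subset ?_ ?_)
      · exact ⟨(⟨_, mem_rIdeal.2 ⟨1, (mul_one _).symm⟩⟩, 0), by simp [hi]⟩
      · rintro _ ⟨b, hb, rfl⟩
        refine ⟨(0, Pi.single ⟨b, hb⟩ ⟨_, mem_rIdeal.2 ⟨1, (mul_one _).symm⟩⟩), ?_⟩
        rw [hi, Finset.sum_eq_single ⟨b, hb⟩]
        · simp
        · intro c _ hc; simp [Pi.single_eq_of_ne hc]
        · simp

/-- The right ideal generated by an arrow which starts no infinite chain of relations has
`Hom(P, -)` exact. -/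
lemma homExact_rIdeal_arrA (hP : ∀ n, Module.Projective (GAlg k Q Rel)ᵐᵒᵖ (P n))
    (hd : ∀ n, (d (n + 1)).comp (d n) = 0) (hA : HomExact P d (GAlg k Q Rel))
    (hcomp : ∀ p ∈ Rel, Q.tgt p.1 = Q.src p.2) {b : Fin Q.nE}
    (hb : Acc (fun c b => (b, c) ∈ Rel) b) :
    HomExact P d (rIdeal (GAlg k Q Rel) (arrA k Q Rel b)) := by
  induction hb with
  | intro b _ ih =>
    let p : GAlg k Q Rel →ₗ[(GAlg k Q Rel)ᵐᵒᵖ] rIdeal (GAlg k Q Rel) (arrA k Q Rel b) :=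
      (orbitMap (arrA k Q Rel b)).codRestrict _ fun x => mem_rIdeal.2 ⟨x, rfl⟩
    refine homExact_of_ker_eq_vIdeal hP hd hA (Q.tgt b) (relSucc Rel b)
      (fun c hc => (hcomp _ hc).symm) (fun c hc => ih c hc) p ?_ ?_
    · rintro ⟨y, hy⟩
      obtain ⟨x, rfl⟩ := mem_rIdeal.1 hy
      exact ⟨x, rfl⟩
    · ext x
      rw [← arrA_mul_eq_zero_iff, LinearMap.mem_ker]
      exact Subtype.ext_iff

end GAlg

/-! ### Directed walks -/

/-- The arrow `b` can follow the arrow `a`. -/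
def QuiverData.Step (Q : QuiverData) (a b : Fin Q.nE) : Prop := Q.tgt a = Q.src b

/-- `f 0, …, f n` is a directed walk from the arrow `a` to the arrow `b`. -/
structure QuiverData.IsWalk (Q : QuiverData) (a b : Fin Q.nE) (n : ℕ) (f : ℕ → Fin Q.nE) :
    Prop where
  pos : 0 < n
  zero : f 0 = a
  last : f n = b
  step : ∀ i < n, Q.Step (f i) (f (i + 1))

namespace QuiverData

variable {Q : QuiverData}

lemma exists_isWalk {a b : Fin Q.nE} (h : Relation.TransGen Q.Step a b) :
    ∃ n f, Q.IsWalk a b n f := by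
  induction h with
  | @single c h =>
    refine ⟨1, fun i => if i = 0 then a else c, one_pos, rfl, rfl, fun i hi => ?_⟩
    obtain rfl : i = 0 := by omega
    exact h
  | @tail c d _ h ih =>
    obtain ⟨n, f, hn, h0, hl, hs⟩ := ih
    refine ⟨n + 1, fun i => if i ≤ n then f i else d, by omega, by simp [h0], by simp, ?_⟩
    intro i hi
    rcases Nat.lt_succ_iff_lt_or_eq.1 hi with hi | rfl
    · simpa [hi.le, Nat.succ_le_iff.2 hi] using hs i hi
    · simpa [hl] using h

/-- The vertices of a shortest closed walk are distinct. -/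
lemma IsWalk.src_injOn {b : Fin Q.nE} {n : ℕ} {f : ℕ → Fin Q.nE} (hf : Q.IsWalk b b n f)
    (hmin : ∀ m < n, ¬ ∃ g, Q.IsWalk b b m g) {i j : ℕ} (hij : i < j) (hj : j < n) :
    Q.src (f i) ≠ Q.src (f j) := by
  intro h
  obtain ⟨-, h0, hl, hs⟩ := hf
  rcases Nat.eq_zero_or_pos i with rfl | hi
  · refine hmin j hj ⟨fun m => if m < j then f m else b, hij, by simp [hij, h0], by simp, ?_⟩
    intro m hm
    rcases Nat.lt_or_ge (m + 1) j with hm' | hm'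
    · simpa [hm, hm'] using hs m (by omega)
    · obtain rfl : j = m + 1 := by omega
      have := hs m (by omega)
      simp only [Step] at this ⊢
      simp [this, ← h, h0]
  · refine hmin (n - (j - i)) (by omega) ⟨fun m => if m < i then f m else f (m + (j - i)),
      by omega, by simp [hi, h0], ?_, ?_⟩
    · rw [if_neg (by omega), ← hl]; congr 1; omega
    · intro m hm
      rcases Nat.lt_trichotomy (m + 1) i with hm' | hm' | hm'
      · simpa [hm', show m < i by omega] using hs m (by omega)
      · have := hs m (by omega)
        simp only [Step] at this ⊢
        rw [if_pos (by omega), if_neg (by omega), this, hm', h]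
        congr 2; omega
      · have := hs (m + (j - i)) (by omega)
        rw [if_neg (by omega), if_neg (by omega)]
        convert this using 2; omega

/-- Every arrow on a directed closed walk is on a cycle. -/
lemma exists_uCycle_of_transGen {b : Fin Q.nE} (h : Relation.TransGen Q.Step b b) :
    ∃ C : UCycle Q, b ∈ C.edgeSet := by
  classical
  have hex : ∃ n f, Q.IsWalk b b n f := exists_isWalk h
  obtain ⟨f, hf⟩ := Nat.find_spec hex
  have hmin := fun m hm => Nat.find_min hex (m := m) hm
  set n := Nat.find hex
  have hn := hf.pos
  have hinj : ∀ i j, i < n → j < n → Q.src (f i) = Q.src (f j) → i = j := by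
    intro i j hi hj hij
    rcases Nat.lt_trichotomy i j with h | h | h
    · exact absurd hij (hf.src_injOn hmin h hj)
    · exact h
    · exact absurd hij.symm (hf.src_injOn hmin h hi)
  refine ⟨⟨n, hn, fun m => f (m % n), fun _ => true, fun m => Q.src (f (m % n)), by simp,
    by simp, by simp, ?_, by simp, ?_, ?_⟩, 0, hn, ?_⟩
  · refine fun i _ => ⟨rfl, ?_⟩
    have hs := hf.step (i % n) (Nat.mod_lt _ hn)
    simp only [Step] at hs
    rw [hs, ← Nat.mod_add_mod i n 1]
    rcases Nat.lt_or_ge (i % n + 1) n with h | h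
    · rw [Nat.mod_eq_of_lt h]
    · have h : i % n + 1 = n := by have := Nat.mod_lt i hn; omega
      rw [h, Nat.mod_self, hf.zero, hf.last]
  · intro i j hi hj
    simp only [Nat.mod_eq_of_lt hi, Nat.mod_eq_of_lt hj]
    exact hinj i j hi hj
  · intro i j hi hj
    simp only [Nat.mod_eq_of_lt hi, Nat.mod_eq_of_lt hj]
    exact fun h => hinj i j hi hj (congrArg _ h)
  · simp [hf.zero]

end QuiverData

namespace FRCycle

variable {k : Type} [Field k] {Q : QuiverData} {Rel : Set (Fin Q.nE × Fin Q.nE)}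
  (C : FRCycle k Q Rel)

lemma arrows_mod (i : ℕ) : C.arrows (i % C.len) = C.arrows i :=
  Function.Periodic.map_mod_nat C.periodic i

lemma arrows_mem (i : ℕ) : C.arrows i ∈ C.arrowSet :=
  ⟨i % C.len, Nat.mod_lt _ (by have := C.len3; omega), C.arrows_mod i⟩

lemma arrows_eq_of_src_eq {i j : ℕ} (h : Q.src (C.arrows i) = Q.src (C.arrows j)) :
    C.arrows i = C.arrows j := by
  have hl : 0 < C.len := by have := C.len3; omega
  rw [← C.arrows_mod i, ← C.arrows_mod j] at h ⊢
  rw [C.vinj _ _ (Nat.mod_lt _ hl) (Nat.mod_lt _ hl) h]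

lemma reflTransGen_arrows (i j : ℕ) :
    Relation.ReflTransGen Q.Step (C.arrows i) (C.arrows j) := by
  have h : ∀ n, Relation.ReflTransGen Q.Step (C.arrows i) (C.arrows (i + n)) := by
    intro n
    induction n with
    | zero => exact .refl
    | succ n ih => exact ih.tail (C.comp _)
  have hl : 1 ≤ C.len := by have := C.len3; omega
  have hle : i ≤ j + i * C.len := by nlinarith
  have hp : C.arrows (j + i * C.len) = C.arrows j := by
    rw [← C.arrows_mod, Nat.add_mul_mod_self_right, C.arrows_mod]
  obtain ⟨n, hn⟩ := Nat.exists_eq_add_of_le hle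
  rw [← hp, hn]
  exact h n

lemma exists_tgt_eq (i : ℕ) : ∃ j, Q.tgt (C.arrows j) = Q.src (C.arrows i) := by
  refine ⟨i + (C.len - 1), ?_⟩
  rw [C.comp, ← C.periodic i]
  have := C.len3
  congr 2; omega

lemma mem_arrowSet_of_rel (h : IsGentle k Q Rel) {b c : Fin Q.nE} (hbc : (b, c) ∈ Rel)
    (hc : c ∈ C.arrowSet) : b ∈ C.arrowSet := by
  obtain ⟨i, -, rfl⟩ := hc
  have hi : C.arrows (i + (C.len - 1) + 1) = C.arrows i := by
    rw [← C.periodic i]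
    have := C.len3
    congr 1; omega
  have hb : inI k Q Rel (arr k Q b * arr k Q (C.arrows i)) := by
    rw [GAlg.inI_arr_mul_arr_iff]
    exact GAlg.arrA_mul_arrA_of_rel hbc
  rw [h.uniq_rel_left (C.arrows i) b (C.arrows (i + (C.len - 1))) (h.comp_rel _ hbc)
    (by rw [C.comp, hi]) hb (by simpa only [hi] using C.frel (i + (C.len - 1)))]
  exact C.arrows_mem _

lemma mem_arrowSet_of_transGen (honecycle : ∀ C' : UCycle Q, C'.edgeSet = C.arrowSet)
    {b : Fin Q.nE} (h : Relation.TransGen Q.Step b b) : b ∈ C.arrowSet := by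
  obtain ⟨C', hC'⟩ := QuiverData.exists_uCycle_of_transGen h
  exact honecycle C' ▸ hC'

/-- No infinite chain of relations starts at an arrow outside the unique cycle. -/
lemma acc_of_notMem (honecycle : ∀ C' : UCycle Q, C'.edgeSet = C.arrowSet)
    (h : IsGentle k Q Rel) {b : Fin Q.nE} (hb : b ∉ C.arrowSet) :
    Acc (fun c b => (b, c) ∈ Rel) b := by
  let r : Fin Q.nE → Fin Q.nE → Prop := fun c b => Relation.TransGen Q.Step b c ∧ b ∉ C.arrowSet
  have : IsTrans (Fin Q.nE) r := ⟨fun _ _ _ hxy hyz => ⟨hyz.1.trans hxy.1, hyz.2⟩⟩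
  have : Std.Irrefl r := ⟨fun b hb => hb.2 (C.mem_arrowSet_of_transGen honecycle hb.1)⟩
  have hwf : WellFounded r := Finite.wellFounded_of_trans_of_irrefl r
  induction b using hwf.induction with
  | _ b ih =>
    exact Acc.intro _ fun c hc =>
      ih c ⟨.single (h.comp_rel _ hc), hb⟩ fun hc' => hb (C.mem_arrowSet_of_rel h hc hc')

/-- The vertices reached after leaving the cycle. -/
def branchVertices : Set (Fin Q.nV) :=
  {w | ∃ b ∉ C.arrowSet, (∃ i, Q.src b = Q.src (C.arrows i)) ∧
    ∃ c, Relation.ReflTransGen Q.Step b c ∧ Q.tgt c = w}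

lemma tgt_mem_branchVertices {a : Fin Q.nE} (h : Q.src a ∈ C.branchVertices) :
    Q.tgt a ∈ C.branchVertices := by
  obtain ⟨b, hb, hi, c, hc, hca⟩ := h
  exact ⟨b, hb, hi, a, hc.tail hca, rfl⟩

lemma src_arrows_notMem_branchVertices
    (honecycle : ∀ C' : UCycle Q, C'.edgeSet = C.arrowSet) (j : ℕ) :
    Q.src (C.arrows j) ∉ C.branchVertices := by
  rintro ⟨b, hb, ⟨i, hi⟩, c, hc, hcj⟩
  obtain ⟨i', hi'⟩ := C.exists_tgt_eq i
  have h₁ : Relation.TransGen Q.Step b (C.arrows j) := .tail' hc hcj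
  have h₂ : Relation.TransGen Q.Step b (C.arrows i') :=
    h₁.trans_left (C.reflTransGen_arrows j i')
  exact hb (C.mem_arrowSet_of_transGen honecycle (h₂.tail (hi'.trans hi.symm)))

lemma eq_arrows_or_tgt_mem_branchVertices {a : Fin Q.nE} {i : ℕ}
    (h : Q.src a = Q.src (C.arrows i)) : a = C.arrows i ∨ Q.tgt a ∈ C.branchVertices := by
  by_cases ha : a ∈ C.arrowSet
  · obtain ⟨j, -, rfl⟩ := ha
    exact .inl (C.arrows_eq_of_src_eq h)
  · exact .inr ⟨a, ha, ⟨i, h⟩, a, .refl, rfl⟩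

end FRCycle

/-! ### The idempotent of the deleted vertices -/

namespace FRCycle

variable {k : Type} [Field k] {Q : QuiverData} {Rel : Set (Fin Q.nE × Fin Q.nE)}
  (C : FRCycle k Q Rel)

lemma vtxA_mul_epsCt {i t : ℕ} (hs : Q.src (C.arrows i) ≠ Q.src (C.arrows t))
    (ht : Q.src (C.arrows i) ≠ Q.tgt (C.arrows t)) :
    vtxA k Q Rel (Q.src (C.arrows i)) * epsCt k Q Rel C t =
      vtxA k Q Rel (Q.src (C.arrows i)) := by
  have hl : 0 < C.len := by have := C.len3; omega
  rw [← C.arrows_mod i] at hs ht ⊢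
  rw [epsCt, Finset.mul_sum, Finset.sum_eq_single (i % C.len), GAlg.vtxA_mul_self]
  · intro j hj hji
    rw [GAlg.vtxA_mul_vtxA, if_neg]
    intro h
    rw [Finset.mem_filter, Finset.mem_range] at hj
    exact hji (C.vinj _ _ hj.1 (Nat.mod_lt _ hl) h.symm)
  · intro h
    exact absurd (Finset.mem_filter.2 ⟨Finset.mem_range.2 (Nat.mod_lt _ hl), hs, ht⟩) h

/-- No nonzero path leads from the source of `a_t` to a deleted vertex. -/
lemma vtxA_mul_mul_epsCt (honecycle : ∀ C' : UCycle Q, C'.edgeSet = C.arrowSet) (t : ℕ)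
    (x : GAlg k Q Rel) :
    vtxA k Q Rel (Q.src (C.arrows t)) * x * epsCt k Q Rel C t = 0 := by
  set T : Set (GAlg k Q Rel) := {x | ∃ u ∈ C.branchVertices, x * vtxA k Q Rel u = x} with hT
  set G : Set (GAlg k Q Rel) :=
    {vtxA k Q Rel (Q.src (C.arrows t)), arrA k Q Rel (C.arrows t)} ∪ T with hG
  have hTG : T ⊆ G := Set.subset_union_right
  have hgenT : ∀ (y : GAlg k Q Rel) a, Q.tgt a ∈ C.branchVertices →
      y * arrA k Q Rel a ∈ Submodule.span k G := fun y a ha =>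
    Submodule.subset_span (hTG ⟨_, ha, by rw [mul_assoc, GAlg.arrA_mul_vtxA_tgt]⟩)
  have hN : ∀ x ∈ Submodule.span k G, x * epsCt k Q Rel C t = 0 := by
    intro x hx
    rw [epsCt, Finset.mul_sum]
    refine Finset.sum_eq_zero fun i hi => ?_
    obtain ⟨-, hs, ht⟩ := Finset.mem_filter.1 hi
    induction hx using Submodule.span_induction with
    | zero => rw [zero_mul]
    | add x y _ _ hx hy => rw [add_mul, hx, hy, add_zero]
    | smul c x _ hx => rw [smul_mul_assoc, hx, smul_zero]
    | mem x hx =>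
      rcases hx with (rfl | rfl) | ⟨u, hu, hxu⟩
      · rw [GAlg.vtxA_mul_vtxA, if_neg hs.symm]
      · rw [GAlg.arrA_mul_vtxA, if_neg ht.symm]
      · rw [← hxu, mul_assoc, GAlg.vtxA_mul_vtxA, if_neg, mul_zero]
        rintro rfl
        exact C.src_arrows_notMem_branchVertices honecycle i hu
  refine hN _ (GAlg.mul_mem_of_gen_right _ ?_ ?_ (Submodule.subset_span (by simp [hG])) x)
  · intro x hx v
    induction hx using Submodule.span_induction with
    | zero => rw [zero_mul]; exact zero_mem _
    | add x y _ _ hx hy => rw [add_mul]; exact add_mem hx hy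
    | smul c x _ hx => rw [smul_mul_assoc]; exact Submodule.smul_mem _ _ hx
    | mem x hx =>
      have hx' := Submodule.subset_span (R := k) hx
      rcases hx with (rfl | rfl) | ⟨u, hu, hxu⟩
      · rw [GAlg.vtxA_mul_vtxA]; split_ifs; exacts [hx', zero_mem _]
      · rw [GAlg.arrA_mul_vtxA]; split_ifs; exacts [hx', zero_mem _]
      · rw [← hxu, mul_assoc, GAlg.vtxA_mul_vtxA]
        split_ifs
        · rwa [hxu]
        · simp
  · intro x hx a
    induction hx using Submodule.span_induction with
    | zero => rw [zero_mul]; exact zero_mem _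
    | add x y _ _ hx hy => rw [add_mul]; exact add_mem hx hy
    | smul c x _ hx => rw [smul_mul_assoc]; exact Submodule.smul_mem _ _ hx
    | mem x hx =>
      rcases hx with (rfl | rfl) | ⟨u, hu, hxu⟩
      · rw [GAlg.vtxA_mul_arrA]
        split_ifs with h
        · rcases C.eq_arrows_or_tgt_mem_branchVertices h with rfl | h
          · exact Submodule.subset_span (by simp [hG])
          · simpa using hgenT 1 a h
        · exact zero_mem _
      · by_cases h : Q.src a = Q.src (C.arrows (t + 1))
        · rcases C.eq_arrows_or_tgt_mem_branchVertices h with rfl | h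
          · rw [GAlg.inI_arr_mul_arr_iff.1 (C.frel t)]; exact zero_mem _
          · exact hgenT _ a h
        · rw [GAlg.arrA_mul_arrA_of_ne]
          · exact zero_mem _
          · rw [C.comp]; exact fun h' => h h'.symm
      · rw [← hxu, mul_assoc, GAlg.vtxA_mul_arrA]
        split_ifs with h
        · exact hgenT _ a (C.tgt_mem_branchVertices (h ▸ hu))
        · simp

end FRCycle

/-! ### Indecomposable modules which cover a simple module -/

namespace GAlg

variable {k : Type} [Field k] {Q : QuiverData} {Rel : Set (Fin Q.nE × Fin Q.nE)}
  {R : Type} [Ring R] {ρ : GAlg k Q Rel →+* R}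

lemma eq_zero_of_algebraMap_smul {S : Type} [AddCommGroup S] [Module Rᵐᵒᵖ S] {s : S} (hs : s ≠ 0)
    {c : k} (hc : op (ρ (algebraMap k _ c)) • s = 0) : c = 0 := by
  by_contra hc0
  apply hs
  have h : op (ρ (algebraMap k _ c * algebraMap k _ c⁻¹)) • s = 0 := by
    rw [map_mul, op_mul, mul_smul, hc, smul_zero]
  rwa [← map_mul, mul_inv_cancel₀ hc0, map_one, map_one, op_one, one_smul] at h

/-- An indecomposable module with a map to `R` which hits the top of `ε_v R` is a retract
of `R`, with image `ε_v R`. -/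
lemma exists_retract (h : IsGentle k Q Rel) (hρ : Function.Surjective ρ) {v : Fin Q.nV}
    {M S : Type} [AddCommGroup M] [Module Rᵐᵒᵖ M] [AddCommGroup S] [Module Rᵐᵒᵖ S]
    (hM : IsIndec Rᵐᵒᵖ M) {s : S} (hs : s ≠ 0)
    (hsa : ∀ a, op (ρ (arrA k Q Rel a)) • s = 0) (hsv : op (ρ (vtxA k Q Rel v)) • s = s)
    (g : M →ₗ[Rᵐᵒᵖ] R) (m : M) (hm : op (g m) • s = s) :
    ∃ (G : M →ₗ[Rᵐᵒᵖ] R) (τ : R →ₗ[Rᵐᵒᵖ] M), (∀ x, τ (G x) = x) ∧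
      ∀ x, G (τ x) = ρ (vtxA k Q Rel v) * x := by
  set e := vtxA k Q Rel v with he
  have hee : e * e = e := vtxA_mul_self v
  obtain ⟨y, hy⟩ := hρ (g m)
  obtain ⟨c, z, hz⟩ := exists_vtxA_mul_eq v (y * e)
  set j := ∑ a with Q.src a = v, arrA k Q Rel a * z a with hj
  have hej : e * j = j := by
    rw [hj, Finset.mul_sum]
    refine Finset.sum_congr rfl fun a ha => ?_
    rw [← mul_assoc, he, vtxA_mul_arrA, if_pos (Finset.mem_filter.1 ha).2]
  have hsj : op (ρ j) • s = 0 := by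
    rw [hj, map_sum, Finset.op_sum, Finset.sum_smul]
    refine Finset.sum_eq_zero fun a _ => ?_
    rw [map_mul, op_mul, mul_smul, hsa, smul_zero]
  have hc : c = 1 := by
    have h1 : op (ρ (e * (y * e))) • s = s := by
      rw [map_mul, map_mul, hy, op_mul, op_mul, mul_smul, mul_smul, hsv, hm, hsv]
    rw [hz, map_add, op_add, add_smul, hsj, add_zero, Algebra.smul_def, Algebra.commutes,
      map_mul, op_mul, mul_smul, hsv] at h1
    refine sub_eq_zero.1 (eq_zero_of_algebraMap_smul (ρ := ρ) hs ?_)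
    rw [map_sub, map_sub, map_one, map_one, op_sub, op_one, sub_smul, one_smul, h1, sub_self]
  obtain ⟨u, hu⟩ := (show IsNilpotent j from isNilpotent_sum_arrA_mul h _ z).isUnit_one_add
  have heu : e * (y * e) * u⁻¹.val = e := by
    rw [hz, hc, one_smul, ← hej, ← he, ← mul_one_add, mul_assoc, ← hu, Units.mul_inv, mul_one]
  have hGτ : ∀ x, ρ e * g (op (ρ (e * u⁻¹.val * e) * x) • m) = ρ e * x := by
    intro x
    rw [map_smul, op_smul_eq_mul, ← hy, ← mul_assoc, ← mul_assoc, ← map_mul, ← map_mul]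
    congr 2
    calc e * y * (e * u⁻¹.val * e) = e * (y * e) * u⁻¹.val * e := by simp only [mul_assoc]
      _ = e := by rw [heu, hee]
  let G : M →ₗ[Rᵐᵒᵖ] R := (orbitMap (ρ e)).comp g
  let τ : R →ₗ[Rᵐᵒᵖ] M := (orbitMap m).comp (orbitMap (ρ (e * u⁻¹.val * e)))
  have hGτ' : ∀ x, G (τ x) = ρ e * x := hGτ
  have hτ : ∀ x, τ (ρ e * x) = τ x := by
    intro x
    change op (ρ (e * u⁻¹.val * e) * (ρ e * x)) • m = op (ρ (e * u⁻¹.val * e) * x) • m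
    rw [← mul_assoc, ← map_mul, mul_assoc (e * u⁻¹.val), hee]
  refine ⟨G, τ, ?_, hGτ'⟩
  have hid : IsIdempotentElem (τ.comp G : Module.End Rᵐᵒᵖ M) := LinearMap.ext fun p => by
    change τ (G (τ (G p))) = τ (G p)
    rw [hGτ', hτ]
  rcases hM.2 _ _ (LinearMap.IsIdempotentElem.isCompl hid) with h0 | h0
  · refine absurd ?_ hs
    have h1 : τ.comp G = 0 := LinearMap.range_eq_bot.1 h0
    have h2 : ρ e = 0 := by
      calc ρ e = G (τ (G (τ 1))) := by rw [hGτ', hGτ', mul_one, ← map_mul, hee]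
        _ = 0 := by rw [show τ (G (τ 1)) = 0 from LinearMap.congr_fun h1 _, map_zero]
    rw [← hsv, h2, op_zero, zero_smul]
  · intro x
    exact LinearMap.ker_eq_bot.1 h0 (LinearMap.congr_fun hid x)

lemma projective_of_lift (h : IsGentle k Q Rel) (hρ : Function.Surjective ρ) {v : Fin Q.nV}
    {M S : Type} [AddCommGroup M] [Module Rᵐᵒᵖ M] [AddCommGroup S] [Module Rᵐᵒᵖ S]
    (hM : IsIndec Rᵐᵒᵖ M) {s : S} (hs : s ≠ 0)
    (hsa : ∀ a, op (ρ (arrA k Q Rel a)) • s = 0) (hsv : op (ρ (vtxA k Q Rel v)) • s = s)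
    (g : M →ₗ[Rᵐᵒᵖ] R) (m : M) (hm : op (g m) • s = s) : Module.Projective Rᵐᵒᵖ M := by
  obtain ⟨G, τ, hτ, -⟩ := exists_retract h hρ hM hs hsa hsv g m hm
  have : Module.Projective Rᵐᵒᵖ R :=
    Module.Projective.of_equiv (opLinearEquiv Rᵐᵒᵖ).symm
  exact Module.Projective.of_split G τ (LinearMap.ext hτ)

lemma equiv_rIdeal_of_lift (h : IsGentle k Q Rel) (hρ : Function.Surjective ρ) {v : Fin Q.nV}
    {M S : Type} [AddCommGroup M] [Module Rᵐᵒᵖ M] [AddCommGroup S] [Module Rᵐᵒᵖ S]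
    (hM : IsIndec Rᵐᵒᵖ M) {s : S} (hs : s ≠ 0)
    (hsa : ∀ a, op (ρ (arrA k Q Rel a)) • s = 0) (hsv : op (ρ (vtxA k Q Rel v)) • s = s)
    (g : M →ₗ[Rᵐᵒᵖ] R) (m : M) (hm : op (g m) • s = s) :
    Nonempty (M ≃ₗ[Rᵐᵒᵖ] rIdeal R (ρ (vtxA k Q Rel v))) := by
  obtain ⟨G, τ, hτ, hG⟩ := exists_retract h hρ hM hs hsa hsv g m hm
  have hr : LinearMap.range G = rIdeal R (ρ (vtxA k Q Rel v)) := by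
    ext x
    rw [mem_rIdeal]
    constructor
    · rintro ⟨p, rfl⟩
      exact ⟨G p, by rw [← hG, hτ]⟩
    · rintro ⟨y, rfl⟩
      exact ⟨τ y, hG y⟩
  exact ⟨(LinearEquiv.ofInjective G (Function.LeftInverse.injective hτ)).trans
    (LinearEquiv.ofEq _ _ hr)⟩

end GAlg

/-! ### Tops of modules -/

lemma orbitMap_surjective {R S : Type} [Ring R] [AddCommGroup S] [Module Rᵐᵒᵖ S]
    [IsSimpleModule Rᵐᵒᵖ S] {s : S} (hs : s ≠ 0) : Function.Surjective (orbitMap (R := R) s) := by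
  rw [← LinearMap.range_eq_top]
  refine (eq_bot_or_eq_top _).resolve_left fun h => hs ?_
  rw [← Submodule.mem_bot Rᵐᵒᵖ, ← h]
  exact ⟨1, by rw [orbitMap_apply, op_one, one_smul]⟩

namespace GAlg

variable {k : Type} [Field k] {Q : QuiverData} {Rel : Set (Fin Q.nE × Fin Q.nE)}

/-- Every nonzero module contains a nonzero element concentrated at one vertex which is
annihilated by all arrows. -/
lemma exists_annihilated (h : IsGentle k Q Rel) {R S : Type} [Ring R] [AddCommGroup S]
    [Module Rᵐᵒᵖ S] [Nontrivial S] (ρ : GAlg k Q Rel →+* R) :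
    ∃ (v : Fin Q.nV) (s : S), s ≠ 0 ∧ (∀ a, op (ρ (arrA k Q Rel a)) • s = 0) ∧
      op (ρ (vtxA k Q Rel v)) • s = s := by
  obtain ⟨s, hs, hsa⟩ : ∃ s : S, s ≠ 0 ∧ ∀ a, op (ρ (arrA k Q Rel a)) • s = 0 := by
    by_contra! hcon
    obtain ⟨s₀, hs₀⟩ := exists_ne (0 : S)
    have key : ∀ n, ∃ l : List (Fin Q.nE), l.length = n ∧
        op (ρ (l.map (arrA k Q Rel)).prod) • s₀ ≠ 0 := by
      intro n
      induction n with
      | zero => exact ⟨[], rfl, by simpa using hs₀⟩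
      | succ n ih =>
        obtain ⟨l, hl, hne⟩ := ih
        obtain ⟨a, ha⟩ := hcon _ hne
        refine ⟨l ++ [a], by simp [hl], ?_⟩
        rw [List.map_append, List.prod_append, map_mul, op_mul, mul_smul]
        simpa using ha
    obtain ⟨m, hm⟩ := h.exists_prod_eq_zero
    obtain ⟨l, hl, hne⟩ := key m
    exact hne (by rw [hm l hl, map_zero, op_zero, zero_smul])
  obtain ⟨v, hv⟩ : ∃ v, op (ρ (vtxA k Q Rel v)) • s ≠ 0 := by
    by_contra! hcon
    apply hs
    calc s = op (ρ (∑ v, vtxA k Q Rel v)) • s := by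
          rw [sum_vtxA, map_one, op_one, one_smul]
      _ = 0 := by
          rw [map_sum, Finset.op_sum, Finset.sum_smul]
          exact Finset.sum_eq_zero fun v _ => hcon v
  refine ⟨v, _, hv, fun a => ?_, ?_⟩
  · rw [← mul_smul, ← op_mul, ← map_mul, vtxA_mul_arrA]
    split_ifs
    · exact hsa a
    · rw [map_zero, op_zero, zero_smul]
  · rw [← mul_smul, ← op_mul, ← map_mul, vtxA_mul_self]

variable {S : Type} [AddCommGroup S] [Module (GAlg k Q Rel)ᵐᵒᵖ S]

lemma ker_orbitMap {v : Fin Q.nV} {s : S} (hs : s ≠ 0)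
    (hsa : ∀ a, op (arrA k Q Rel a) • s = 0) (hsv : op (vtxA k Q Rel v) • s = s) :
    LinearMap.ker (orbitMap s) = vIdeal k Q Rel v {b | Q.src b = v} := by
  apply le_antisymm
  · intro x hx
    replace hx : op x • s = 0 := hx
    obtain ⟨c, y, hy⟩ := exists_vtxA_mul_eq v x
    have hc : c = 0 := by
      have h1 : op (vtxA k Q Rel v * x) • s = 0 := by rw [op_mul, mul_smul, hsv, hx]
      rw [hy, op_add, add_smul, Finset.op_sum, Finset.sum_smul, Finset.sum_eq_zero, add_zero,
        Algebra.smul_def, Algebra.commutes, op_mul, mul_smul, hsv] at h1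
      · exact eq_zero_of_algebraMap_smul (ρ := RingHom.id _) hs h1
      · intro a _
        rw [op_mul, mul_smul, hsa, smul_zero]
    have hx : x = (1 - vtxA k Q Rel v) * x + vtxA k Q Rel v * x := by
      rw [sub_mul, one_mul, sub_add_cancel]
    rw [hx, hy, hc, zero_smul, zero_add]
    exact add_mem (mul_mem_right _ (one_sub_vtxA_mem_vIdeal _ _) _)
      (Submodule.sum_mem _ fun a ha =>
        mul_mem_right _ (arrA_mem_vIdeal _ (Finset.mem_filter.1 ha).2) _)
  · refine Submodule.span_le.2 (Set.insert_subset ?_ ?_)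
    · change op (1 - vtxA k Q Rel v) • s = 0
      rw [op_sub, op_one, sub_smul, one_smul, hsv, sub_self]
    · rintro _ ⟨b, -, rfl⟩
      exact hsa b

/-- An indecomposable Gorenstein projective module with a simple quotient at a vertex outside
the unique cycle is projective. -/
lemma projective_of_isGProjMod (h : IsGentle k Q Rel) (C : FRCycle k Q Rel)
    (honecycle : ∀ C' : UCycle Q, C'.edgeSet = C.arrowSet) {v : Fin Q.nV}
    (hv : ∀ i, v ≠ Q.src (C.arrows i)) {M : Type} [AddCommGroup M]
    [Module (GAlg k Q Rel)ᵐᵒᵖ M] (hG : IsGProjMod (GAlg k Q Rel) M)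
    (hM : IsIndec (GAlg k Q Rel)ᵐᵒᵖ M) {s : S} (hs : s ≠ 0)
    (hsa : ∀ a, op (arrA k Q Rel a) • s = 0) (hsv : op (vtxA k Q Rel v) • s = s)
    (hS : Function.Surjective (orbitMap (R := GAlg k Q Rel) s))
    (q : M →ₗ[(GAlg k Q Rel)ᵐᵒᵖ] S) (m : M) (hq : q m = s) :
    Module.Projective (GAlg k Q Rel)ᵐᵒᵖ M := by
  obtain ⟨P, d, -, hP, hex, hHom, ⟨e⟩⟩ := hG
  have hd : ∀ n, (d (n + 1)).comp (d n) = 0 := fun n => LinearMap.ext fun x => by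
    change d (n + 1) (d n x) = 0
    rw [← LinearMap.mem_ker, ← hex]
    exact LinearMap.mem_range_self _ _
  have hA : HomExact P d (GAlg k Q Rel) := fun n g hg => (hHom n g).1 hg
  have hS' : HomExact P d S := by
    refine homExact_of_ker_eq_vIdeal hP hd hA v {b | Q.src b = v} (fun _ hb => hb) ?_
      (orbitMap s) hS (ker_orbitMap hs hsa hsv)
    intro b hb
    refine homExact_rIdeal_arrA hP hd hA h.comp_rel (C.acc_of_notMem honecycle h ?_)
    rintro ⟨i, -, rfl⟩
    exact hv i hb.symm
  obtain ⟨g, hg⟩ := hS'.exists_lift hP hd (-1) e q (orbitMap s) hS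
  exact projective_of_lift (ρ := RingHom.id _) h Function.surjective_id hM hs hsa hsv g m
    ((LinearMap.congr_fun hg m).trans hq)

end GAlg

/-! ### The quotient by an idempotent -/

section QuotBy

variable {R : Type} [Ring R] {ε : R}

lemma qmap_surjective : Function.Surjective (qmap R ε) := RingQuot.mkRingHom_surjective _

lemma qmap_self : qmap R ε ε = 0 :=
  (RingQuot.mkRingHom_rel (r := QuotRel R ε) ⟨rfl, rfl⟩).trans (map_zero _)

/-- Left multiplication by `e` descends to `R/RεR` if `eRε = 0`. -/
lemma exists_mul_descent {e : R} (he : ∀ x, e * x * ε = 0) :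
    ∃ σ : QuotBy R ε →+ R, ∀ x, σ (qmap R ε x) = e * x := by
  let f : R →+* (AddMonoid.End (rIdeal R e))ᵐᵒᵖ :=
    { toFun x := op (Module.toAddMonoidEnd Rᵐᵒᵖ (rIdeal R e) (op x))
      map_one' := by simp
      map_zero' := by simp
      map_add' x y := by simp
      map_mul' x y := by simp }
  have hf : ∀ ⦃x y⦄, QuotRel R ε x y → f x = f y := by
    rintro x y ⟨rfl, rfl⟩
    rw [map_zero]
    refine unop_injective (AddMonoidHom.ext fun z => Subtype.ext ?_)
    obtain ⟨y, hy⟩ := mem_rIdeal.1 z.2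
    change (z : R) * x = 0
    rw [hy, he]
  let F : QuotBy R ε →+* (AddMonoid.End (rIdeal R e))ᵐᵒᵖ := RingQuot.lift ⟨f, hf⟩
  have hF : ∀ x, F (qmap R ε x) = f x := fun x => RingQuot.lift_mkRingHom_apply f hf x
  refine ⟨AddMonoidHom.mk' (fun a => ((F a).unop ⟨e, mem_rIdeal.2 ⟨1, (mul_one e).symm⟩⟩ : R))
    fun a b => by rw [map_add]; rfl, fun x => ?_⟩
  change (((F (qmap R ε x)).unop ⟨e, _⟩ : rIdeal R e) : R) = e * x
  rw [hF]
  rfl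

end QuotBy

/-- Theorem `thm:main 2` (2).  Let `A = kQ/I` be a gentle
one-cycle algebra whose unique cycle `𝒞 = a_1 ⋯ a_l` is a full-relational
oriented cycle, `t < l`.  Then every (finitely generated) indecomposable
projective right `Ā_{𝒞,t}`-module `P` with `P ≇ ε̄_{t(a_t)} Ā_{𝒞,t}`, viewed as a
right `A`-module via the quotient map `A → Ā_{𝒞,t}`, is not a non-projective
indecomposable Gorenstein projective `A`-module. -/
theorem stmt11 (k : Type) [Field k] [IsAlgClosed k] (Q : QuiverData)
    (Rel : Set (Fin Q.nE × Fin Q.nE)) (hgentle : IsGentle k Q Rel)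
    (hfd : Module.Finite k (GAlg k Q Rel)) (hns : NoShortFRC k Q Rel)
    (C : FRCycle k Q Rel) (honecycle : ∀ C' : UCycle Q, C'.edgeSet = C.arrowSet)
    (t : ℕ) (ht : t < C.len) :
    let A := GAlg k Q Rel
    let ε := epsCt k Q Rel C t
    let Abar := QuotBy A ε
    let π := qmap A ε
    ∀ P : ModuleCat.{0} Abarᵐᵒᵖ, Module.Finite Abarᵐᵒᵖ P →
      Module.Projective Abarᵐᵒᵖ P → IsIndec Abarᵐᵒᵖ P →
      ¬ Nonempty (P ≃ₗ[Abarᵐᵒᵖ]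
        ↥(rIdeal Abar (π (vtxA k Q Rel (Q.tgt (C.arrows t)))))) →
      ¬ RestrIsNPIGProj π P := by
  intro A ε Abar π P hfin hproj hindec hne hNPI
  have hπ : Function.Surjective π := qmap_surjective
  have := hindec.1
  obtain ⟨N, hN, -⟩ :=
    (eq_top_or_exists_le_coatom (⊥ : Submodule Abarᵐᵒᵖ P)).resolve_left bot_ne_top
  have hsimple : IsSimpleModule Abarᵐᵒᵖ (P ⧸ N) := isSimpleModule_iff_isCoatom.2 hN
  have := IsSimpleModule.nontrivial Abarᵐᵒᵖ (P ⧸ N)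
  obtain ⟨v, s, hs, hsa, hsv⟩ := GAlg.exists_annihilated (S := P ⧸ N) hgentle π
  have hsurj : Function.Surjective (orbitMap (R := Abar) s) := orbitMap_surjective hs
  obtain ⟨m, hm⟩ := N.mkQ_surjective s
  obtain ⟨g, hg⟩ := Module.projective_lifting_property (orbitMap s) N.mkQ hsurj
  have hgm : op (g m) • s = s := (LinearMap.congr_fun hg m).trans hm
  let _ := modRestrict π P
  let _ := modRestrict π (P ⧸ N)
  obtain ⟨hG, hindecA, hnproj⟩ : IsNPIGProj A P := hNPI
  by_cases hv : ∃ i, v = Q.src (C.arrows i)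
  · obtain ⟨i, rfl⟩ := hv
    by_cases hvs : Q.src (C.arrows i) = Q.src (C.arrows t)
    · rw [hvs] at hsv
      obtain ⟨σ, hσ⟩ := exists_mul_descent (C.vtxA_mul_mul_epsCt honecycle t)
      let g' : P →ₗ[Aᵐᵒᵖ] A :=
        { toFun x := σ (g x)
          map_add' x y := by rw [map_add, map_add]
          map_smul' a x := by
            obtain ⟨y, hy⟩ := hπ (g x)
            change σ (g (op (π a.unop) • x)) = σ (g x) * a.unop
            rw [map_smul, op_smul_eq_mul, ← hy, ← map_mul, hσ, hσ, mul_assoc] }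
      refine hnproj (GAlg.projective_of_lift (ρ := RingHom.id _) hgentle Function.surjective_id
        hindecA hs hsa hsv g' m ?_)
      obtain ⟨y, hy⟩ := hπ (g m)
      change op (π (σ (g m))) • s = s
      rw [← hy, hσ, map_mul, op_mul, mul_smul, hsv, hy, hgm]
    by_cases hvt : Q.src (C.arrows i) = Q.tgt (C.arrows t)
    · rw [hvt] at hsv
      exact hne (GAlg.equiv_rIdeal_of_lift hgentle hπ hindec hs hsa hsv g m hgm)
    · apply hs
      rw [← hsv, ← C.vtxA_mul_epsCt hvs hvt, map_mul, show π ε = 0 from qmap_self, mul_zero,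
        op_zero, zero_smul]
  · push Not at hv
    let q : P →ₗ[Aᵐᵒᵖ] P ⧸ N :=
      { toFun := N.mkQ
        map_add' := map_add _
        map_smul' a x := N.mkQ.map_smul (op (π a.unop)) x }
    exact hnproj (GAlg.projective_of_isGProjMod hgentle C honecycle hv hG hindecA hs hsa hsv
      (hsurj.comp hπ) q m hm)
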